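/- Let k ≥ 1 be an integer. There exist constants c > 0 and C = C(k) such that for every odd prime q and every real X with 2 ≤ X ≤ q: | ∑_{m₁,…,m_k,n₁,…,n_k ≥ 1, m̄ ≡ n̄ mod q(m̄·n̄)} φ(q(m̄·n̄)) · (∏_{i=1}^{k} Λ(m_i)Λ(n_i)) · e^{−m̄·n̄/X}/(m̄·n̄) − ∑_{χ mod q, χ ≠ χ₀} |L'/L(1, χ)|^{2k} | ≤ C · ( q^{3/5} · X^{−c/log q} + q · X^{−1/10} ), where m̄ = m₁⋯m_k and n̄ = n₁⋯n_k. -/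

import Mathlib

open ArithmeticFunction

/-- `Λ^{*k}`, the `k`-fold Dirichlet convolution of the von Mangoldt function
with itself, realized as the `k`-th power of `Λ` in the ring of arithmetic
functions (whose multiplication is Dirichlet convolution). -/
noncomputable def vonMangoldtConv (k : ℕ) : ArithmeticFunction ℝ := vonMangoldt ^ k

/-- `M_k = ∑_{m ≥ 1} (Λ^{*k}(m))² / m²`. -/
noncomputable def momentConst (k : ℕ) : ℝ :=
  ∑' m : ℕ, (vonMangoldtConv k m) ^ 2 / (m : ℝ) ^ 2

/-- `coprimePart q N` is the largest divisor of `q` that is coprime to `N`. -/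
def coprimePart (q N : ℕ) : ℕ :=
  Nat.findGreatest (fun d => d ∣ q ∧ Nat.Coprime d N) q

/-- `∑_{χ mod q, χ ≠ χ₀} |L'/L(1, χ)|^{2k}`, the `2k`-th power moment of
`|L'/L(1,·)|` over the non-principal Dirichlet characters modulo `q`
(defined to be `0` for `q < 2`). -/
noncomputable def charMomentSum (q k : ℕ) : ℝ :=
  if h : 2 ≤ q then by
    haveI : NeZero q := ⟨by omega⟩
    exact ∑ χ : DirichletCharacter ℂ q,
      if χ ≠ 1 then
        ‖logDeriv (DirichletCharacter.LFunction χ) 1‖ ^ (2 * k)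
      else 0
  else 0

namespace TEC
open Finset

lemma sum_range_zmod (q : ℕ) [NeZero q] (f : ZMod q → ℂ) :
    ∑ i ∈ range q, f (i : ZMod q) = ∑ a, f a := by
  refine Finset.sum_bij' (fun i _ => (i : ZMod q)) (fun a _ => a.val) ?_ ?_ ?_ ?_ ?_
  · intros; simp
  · intro a _; simpa using ZMod.val_lt a
  · intro i hi; simpa using ZMod.val_cast_of_lt (by simpa using hi)
  · intro a _; simp
  · intros; rfl

lemma sum_range_mul (q : ℕ) [NeZero q] {χ : DirichletCharacter ℂ q} (hχ : χ ≠ 1) (m : ℕ) :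
    ∑ i ∈ range (q * m), χ (i : ZMod q) = 0 := by
  induction m with
  | zero => simp
  | succ m ih =>
    rw [Nat.mul_succ, sum_range_add, ih, zero_add]
    have := sum_range_zmod q (fun a => χ a)
    simp only [Nat.cast_add, Nat.cast_mul, CharP.cast_eq_zero, zero_mul, zero_add]
    rw [this]
    exact MulChar.sum_eq_zero_of_ne_one hχ

lemma norm_charsum_le (q : ℕ) [NeZero q] {χ : DirichletCharacter ℂ q} (hχ : χ ≠ 1) (n : ℕ) :
    ‖∑ i ∈ range n, χ (i : ZMod q)‖ ≤ q := by
  conv_lhs => rw [← Nat.div_add_mod n q]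
  rw [sum_range_add, sum_range_mul q hχ, zero_add]
  calc _ ≤ ∑ i ∈ range (n % q), ‖χ ((q * (n / q) + i : ℕ) : ZMod q)‖ := norm_sum_le _ _
    _ ≤ ∑ i ∈ range (n % q), 1 := sum_le_sum fun i _ => χ.norm_le_one _
    _ = ((n % q : ℕ) : ℝ) := by simp
    _ ≤ q := by exact_mod_cast (Nat.mod_lt _ (NeZero.pos q)).le

/-- partial sums `χ(1)+...+χ(n)` -/
noncomputable def SS {q : ℕ} (χ : DirichletCharacter ℂ q) (n : ℕ) : ℂ :=
  ∑ i ∈ range n, χ ((i + 1 : ℕ) : ZMod q)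

lemma norm_SS_le {q : ℕ} [NeZero q] {χ : DirichletCharacter ℂ q} (hχ : χ ≠ 1) (n : ℕ) :
    ‖SS χ n‖ ≤ q := by
  have h1 : q ≠ 1 := by
    rintro rfl
    exact hχ (Subsingleton.elim _ _)
  have : Fact (1 < q) := ⟨by have := NeZero.ne q; omega⟩
  have h := norm_charsum_le q hχ (n + 1)
  rw [sum_range_succ'] at h
  have h0 : χ (0 : ZMod q) = 0 := χ.map_nonunit (by simp)
  simpa [SS, h0] using h

/-- partial sums of the L-series -/
noncomputable def PS {q : ℕ} (χ : DirichletCharacter ℂ q) (M : ℕ) (s : ℂ) : ℂ :=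
  ∑ n ∈ range M, χ ((n + 1 : ℕ) : ZMod q) * (((n + 1 : ℕ) : ℂ)) ^ (-s)

noncomputable def tt {q : ℕ} (χ : DirichletCharacter ℂ q) (n : ℕ) (s : ℂ) : ℂ :=
  SS χ (n + 1) * ((((n + 1 : ℕ) : ℂ)) ^ (-s) - (((n + 2 : ℕ) : ℂ)) ^ (-s))

lemma abel {q : ℕ} (χ : DirichletCharacter ℂ q) (M : ℕ) (s : ℂ) :
    PS χ M s = SS χ M * (((M + 1 : ℕ) : ℂ)) ^ (-s) + ∑ n ∈ range M, tt χ n s := by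
  induction M with
  | zero => simp [PS, SS]
  | succ M ih =>
    have h1 : PS χ (M + 1) s = PS χ M s + χ ((M + 1 : ℕ) : ZMod q) * (((M + 1 : ℕ) : ℂ)) ^ (-s) := by
      simp only [PS]; rw [sum_range_succ]
    have h2 : SS χ (M + 1) = SS χ M + χ ((M + 1 : ℕ) : ZMod q) := by
      simp only [SS]; rw [sum_range_succ]
    rw [h1, ih, sum_range_succ, tt, h2]
    ring

lemma cpow_diff (n : ℕ) (s : ℂ) (hs : 0 < s.re) :
    ‖(((n + 1 : ℕ) : ℂ)) ^ (-s) - (((n + 2 : ℕ) : ℂ)) ^ (-s)‖ ≤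
      ‖s‖ * ((n + 1 : ℕ) : ℝ) ^ (-s.re - 1) := by
  have hs0 : s ≠ 0 := by rintro rfl; simp at hs
  have key := Convex.norm_image_sub_le_of_norm_hasDerivWithin_le (𝕜 := ℝ)
    (f := fun y : ℝ => (y : ℂ) ^ (-s)) (f' := fun y : ℝ => (-s) * (y : ℂ) ^ (-s - 1))
    (s := Set.Icc ((n + 1 : ℕ) : ℝ) ((n + 2 : ℕ) : ℝ)) (C := ‖s‖ * ((n + 1 : ℕ) : ℝ) ^ (-s.re - 1))
    (x := ((n + 1 : ℕ) : ℝ)) (y := ((n + 2 : ℕ) : ℝ)) ?_ ?_ (convex_Icc _ _) ?_ ?_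
  · rw [norm_sub_rev]
    have h1 : ‖((n + 2 : ℕ) : ℝ) - ((n + 1 : ℕ) : ℝ)‖ = 1 := by push_cast; ring_nf; simp
    rw [h1, mul_one] at key
    simpa using key
  · intro x hx
    have hx0 : 0 < x := lt_of_lt_of_le (by positivity) hx.1
    have := (hasDerivAt_ofReal_cpow_const' hx0.ne' (r := -s - 1) (by
      intro h; apply hs0; linear_combination -h))
    have h2 := (this.const_mul (-s)).hasDerivWithinAt (s := Set.Icc ((n + 1 : ℕ) : ℝ) ((n + 2 : ℕ) : ℝ))
    convert h2 using 1
    funext y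
    have : -s - 1 + 1 = -s := by ring
    rw [this]; field_simp
  · intro x hx
    have hx0 : 0 < x := lt_of_lt_of_le (by positivity) hx.1
    rw [norm_mul, norm_neg, Complex.norm_cpow_eq_rpow_re_of_pos hx0]
    gcongr
    simp only [Complex.sub_re, Complex.neg_re, Complex.one_re]
    exact Real.rpow_le_rpow_of_nonpos (by positivity) hx.1 (by linarith)
  · simp
  · simp

lemma norm_tt_le {q : ℕ} [NeZero q] {χ : DirichletCharacter ℂ q} (hχ : χ ≠ 1) (n : ℕ) (s : ℂ)
    (hs : 0 < s.re) : ‖tt χ n s‖ ≤ q * (‖s‖ * ((n + 1 : ℕ) : ℝ) ^ (-s.re - 1)) := by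
  rw [tt, norm_mul]
  exact mul_le_mul (norm_SS_le hχ _) (cpow_diff n s hs) (norm_nonneg _) (by positivity)

lemma summable_54 : Summable (fun n : ℕ => ((n + 1 : ℕ) : ℝ) ^ (-(5 / 4 : ℝ))) :=
  (summable_nat_add_iff 1 (f := fun n : ℕ => (n : ℝ) ^ (-(5 / 4 : ℝ)))).2
    (Real.summable_nat_rpow.2 (by norm_num))

lemma norm_tt_add_le {q : ℕ} [NeZero q] {χ : DirichletCharacter ℂ q} (hχ : χ ≠ 1) (n M : ℕ) (s : ℂ)
    (hs : 1 / 4 ≤ s.re) : ‖tt χ (n + M) s‖ ≤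
      (q * ‖s‖ * ((M + 1 : ℕ) : ℝ) ^ (-(s.re - 1 / 4))) * ((n + 1 : ℕ) : ℝ) ^ (-(5 / 4 : ℝ)) := by
  refine (norm_tt_le hχ (n + M) s (by linarith)).trans ?_
  have h1 : ((n + M + 1 : ℕ) : ℝ) ^ (-s.re - 1) =
      ((n + M + 1 : ℕ) : ℝ) ^ (-(s.re - 1 / 4)) * ((n + M + 1 : ℕ) : ℝ) ^ (-(5 / 4 : ℝ)) := by
    rw [← Real.rpow_add (by positivity)]; congr 1; ring
  rw [h1, mul_assoc, mul_assoc, ]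
  gcongr ?_ * (?_ * ?_)
  gcongr ?_ * ?_
  · exact Real.rpow_le_rpow_of_nonpos (by positivity) (by push_cast; linarith [(Nat.cast_nonneg n : (0:ℝ) ≤ n)]) (by linarith)
  · exact Real.rpow_le_rpow_of_nonpos (by positivity) (by push_cast; linarith [(Nat.cast_nonneg M : (0:ℝ) ≤ M)]) (by linarith)

lemma summable_tt {q : ℕ} [NeZero q] {χ : DirichletCharacter ℂ q} (hχ : χ ≠ 1) (s : ℂ)
    (hs : 1 / 4 ≤ s.re) : Summable (fun n => tt χ n s) := by
  refine Summable.of_norm_bounded (summable_54.mul_left _) fun n => norm_tt_add_le hχ n 0 s hs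

lemma LFunction_eq_tsum_of_one_lt {q : ℕ} [NeZero q] {χ : DirichletCharacter ℂ q} (hχ : χ ≠ 1)
    (s : ℂ) (hs : 1 < s.re) : DirichletCharacter.LFunction χ s = ∑' n, tt χ n s := by
  rw [DirichletCharacter.LFunction_eq_LSeries χ hs]
  have hsum := (DirichletCharacter.LSeriesSummable_of_one_lt_re χ hs)
  have h1 := hsum.hasSum.tendsto_sum_nat
  have h1' := h1.comp (Filter.tendsto_add_atTop_nat 1)
  have h2 := (summable_tt hχ s (by linarith)).hasSum.tendsto_sum_nat
  have h3 : Filter.Tendsto (fun M : ℕ => SS χ M * (((M + 1 : ℕ) : ℂ)) ^ (-s)) Filter.atTop (nhds 0) := by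
    apply squeeze_zero_norm (a := fun M : ℕ => (q : ℝ) * ((M + 1 : ℕ) : ℝ) ^ (-s.re))
    · intro M
      rw [norm_mul, Complex.norm_natCast_cpow_of_pos (by positivity)]
      exact mul_le_mul (norm_SS_le hχ _) le_rfl (by positivity) (by positivity)
    · have : Filter.Tendsto (fun M : ℕ => ((M + 1 : ℕ) : ℝ) ^ (-s.re)) Filter.atTop (nhds 0) :=
        (tendsto_rpow_neg_atTop (y := s.re) (by linarith)).comp
          (tendsto_natCast_atTop_atTop.comp (Filter.tendsto_add_atTop_nat 1))
      simpa using this.const_mul (q : ℝ)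
  have h4 := h3.add h2
  rw [zero_add] at h4
  refine tendsto_nhds_unique h1' (h4.congr fun M => ?_)
  rw [← abel, Function.comp, sum_range_succ']
  simp only [LSeries.term_zero, add_zero, PS]
  refine sum_congr rfl fun n _ => ?_
  rw [LSeries.term_of_ne_zero (by omega), Complex.cpow_neg]
  rfl

lemma LFunction_eq_tsum {q : ℕ} [NeZero q] {χ : DirichletCharacter ℂ q} (hχ : χ ≠ 1)
    (s : ℂ) (hs : 1 / 4 < s.re) : DirichletCharacter.LFunction χ s = ∑' n, tt χ n s := by
  set U : Set ℂ := {z : ℂ | 1 / 4 < z.re} ∩ Metric.ball 0 (‖s‖ + 3) with hU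
  have hUo : IsOpen U := (isOpen_lt continuous_const Complex.continuous_re).inter Metric.isOpen_ball
  have hUc : Convex ℝ U := (convex_halfSpace_re_gt _).inter (convex_ball _ _)
  have hd1 : DifferentiableOn ℂ (DirichletCharacter.LFunction χ) U :=
    (DirichletCharacter.differentiable_LFunction hχ).differentiableOn
  have hd2 : DifferentiableOn ℂ (fun s => ∑' n, tt χ n s) U := by
    refine Complex.differentiableOn_tsum_of_summable_norm
      (summable_54.mul_left (q * (‖s‖ + 3))) ?_ hUo ?_
    · intro n
      unfold tt
      have h1 : ((n + 1 : ℕ) : ℂ) ≠ 0 := by exact_mod_cast (Nat.succ_ne_zero n)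
      have h2 : ((n + 2 : ℕ) : ℂ) ≠ 0 := by exact_mod_cast (Nat.succ_ne_zero (n+1))
      apply Differentiable.differentiableOn
      apply Differentiable.const_mul
      exact (differentiable_id.neg.const_cpow (Or.inl h1)).sub
        (differentiable_id.neg.const_cpow (Or.inl h2))
    · intro n w hw
      refine (norm_tt_add_le hχ n 0 w hw.1.le).trans ?_
      have := hw.2
      simp at this
      simp
      gcongr
  have h2U : (2 : ℂ) ∈ U := by
    refine ⟨by simp; norm_num, ?_⟩
    simp; linarith [norm_nonneg s]
  have hev : DirichletCharacter.LFunction χ =ᶠ[nhds 2] (fun s => ∑' n, tt χ n s) := by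
    have : {z : ℂ | 1 < z.re} ∈ nhds (2 : ℂ) :=
      (isOpen_lt continuous_const Complex.continuous_re).mem_nhds (by simp)
    filter_upwards [this] with z hz
    exact LFunction_eq_tsum_of_one_lt hχ z hz
  exact (hd1.analyticOnNhd hUo).eqOn_of_preconnected_of_eventuallyEq (hd2.analyticOnNhd hUo)
    hUc.isPreconnected h2U hev ⟨hs, by simp⟩

/-- approximation of `L(s,χ)` by partial sums -/
lemma LFunction_approx : ∃ K : ℝ, 0 < K ∧ ∀ (q : ℕ) [NeZero q] (χ : DirichletCharacter ℂ q), χ ≠ 1 →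
    ∀ (s : ℂ), 1 / 4 < s.re → ∀ M : ℕ, ‖DirichletCharacter.LFunction χ s - PS χ M s‖ ≤
      K * q * (1 + ‖s‖) * ((M + 1 : ℕ) : ℝ) ^ (-(s.re - 1 / 4)) := by
  refine ⟨1 + ∑' n : ℕ, ((n + 1 : ℕ) : ℝ) ^ (-(5 / 4 : ℝ)), ?_, ?_⟩
  · have : 0 ≤ ∑' n : ℕ, ((n + 1 : ℕ) : ℝ) ^ (-(5 / 4 : ℝ)) := tsum_nonneg fun n => by positivity
    linarith
  intro q _ χ hχ s hs M
  set T := ∑' n : ℕ, ((n + 1 : ℕ) : ℝ) ^ (-(5 / 4 : ℝ)) with hT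
  have hT0 : 0 ≤ T := tsum_nonneg fun n => by positivity
  have h1 := (summable_tt hχ s hs.le).sum_add_tsum_nat_add M
  have h2 : DirichletCharacter.LFunction χ s - PS χ M s =
      (∑' n, tt χ (n + M) s) - SS χ M * (((M + 1 : ℕ) : ℂ)) ^ (-s) := by
    rw [LFunction_eq_tsum hχ s hs, abel, ← h1]; ring
  rw [h2]
  set X := ((M + 1 : ℕ) : ℝ) ^ (-(s.re - 1 / 4)) with hX
  have hX0 : 0 ≤ X := by positivity
  have h3 : ‖∑' n, tt χ (n + M) s‖ ≤ (q * ‖s‖ * X) * T :=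
    tsum_of_norm_bounded (summable_54.hasSum.mul_left _) fun n => norm_tt_add_le hχ n M s hs.le
  have h4 : ‖SS χ M * (((M + 1 : ℕ) : ℂ)) ^ (-s)‖ ≤ q * X := by
    rw [norm_mul, Complex.norm_natCast_cpow_of_pos (by positivity)]
    refine mul_le_mul (norm_SS_le hχ _) ?_ (by positivity) (by positivity)
    exact Real.rpow_le_rpow_of_exponent_le (by push_cast; linarith [(Nat.cast_nonneg M : (0:ℝ) ≤ M)])
      (by simp)
  refine (norm_sub_le _ _).trans ((add_le_add h3 h4).trans ?_)
  have : 0 ≤ (q : ℝ) * X * ‖s‖ := by positivity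
  have h5 : 0 ≤ (q : ℝ) * X * T := by positivity
  nlinarith

end TEC

namespace TEC
open Finset

/-- partial sums of the negated derivative of the L-series -/
noncomputable def PSd {q : ℕ} (χ : DirichletCharacter ℂ q) (M : ℕ) (s : ℂ) : ℂ :=
  ∑ n ∈ range M, χ ((n + 1 : ℕ) : ZMod q) * ((Real.log (n + 1 : ℕ) : ℝ) : ℂ) *
    (((n + 1 : ℕ) : ℂ)) ^ (-s)

lemma hasDerivAt_PS {q : ℕ} (χ : DirichletCharacter ℂ q) (M : ℕ) (s : ℂ) :
    HasDerivAt (PS χ M) (-PSd χ M s) s := by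
  unfold PS PSd
  rw [← sum_neg_distrib]
  apply HasDerivAt.fun_sum
  intro n _
  have h1 : ((n + 1 : ℕ) : ℂ) ≠ 0 := by exact_mod_cast (Nat.succ_ne_zero n)
  have := (((hasDerivAt_id s).neg).const_cpow (c := ((n + 1 : ℕ) : ℂ)) (Or.inl h1)).const_mul
    (χ ((n + 1 : ℕ) : ZMod q))
  refine this.congr_deriv ?_
  rw [Complex.ofReal_log (by positivity)]
  simp
  ring

lemma harm_le (M : ℕ) : ∑ n ∈ range M, (1 : ℝ) / ((n + 1 : ℕ) : ℝ) ≤ 1 + Real.log M := by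
  have := harmonic_le_one_add_log M
  simpa [harmonic] using this

lemma one_le_ell {q : ℕ} [NeZero q] : 1 ≤ 1 + Real.log q := by
  have : (1 : ℝ) ≤ q := by exact_mod_cast NeZero.one_le
  linarith [Real.log_nonneg this]

lemma norm_PS_le {q : ℕ} (χ : DirichletCharacter ℂ q) (M : ℕ) (s : ℂ) (hs : 1 ≤ s.re) :
    ‖PS χ M s‖ ≤ 1 + Real.log M := by
  refine le_trans ?_ (harm_le M)
  refine (norm_sum_le _ _).trans (sum_le_sum fun n _ => ?_)
  rw [norm_mul, Complex.norm_natCast_cpow_of_pos (by positivity)]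
  have h1 : ((n + 1 : ℕ) : ℝ) ^ (-s).re ≤ ((n + 1 : ℕ) : ℝ) ^ (-1 : ℝ) :=
    Real.rpow_le_rpow_of_exponent_le (by push_cast; linarith [(Nat.cast_nonneg n : (0:ℝ) ≤ n)])
      (by simpa using hs)
  rw [Real.rpow_neg_one] at h1
  calc _ ≤ 1 * (((n + 1 : ℕ) : ℝ))⁻¹ :=
        mul_le_mul (χ.norm_le_one _) h1 (by positivity) zero_le_one
    _ = _ := by rw [one_mul, one_div]

lemma norm_PSd_le {q : ℕ} (χ : DirichletCharacter ℂ q) (M : ℕ) (s : ℂ) (hs : 1 ≤ s.re) :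
    ‖PSd χ M s‖ ≤ Real.log M * (1 + Real.log M) := by
  refine le_trans ?_ (mul_le_mul_of_nonneg_left (harm_le M) (Real.log_natCast_nonneg M))
  rw [mul_sum]
  refine (norm_sum_le _ _).trans (sum_le_sum fun n hn => ?_)
  rw [norm_mul, norm_mul, Complex.norm_natCast_cpow_of_pos (by positivity)]
  have h1 : ((n + 1 : ℕ) : ℝ) ^ (-s).re ≤ ((n + 1 : ℕ) : ℝ) ^ (-1 : ℝ) :=
    Real.rpow_le_rpow_of_exponent_le (by push_cast; linarith [(Nat.cast_nonneg n : (0:ℝ) ≤ n)])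
      (by simpa using hs)
  rw [Real.rpow_neg_one] at h1
  have h2 : Real.log ((n + 1 : ℕ) : ℝ) ≤ Real.log M := by
    apply Real.log_le_log (by positivity)
    exact_mod_cast mem_range.1 hn
  have h3 : ‖((Real.log (n + 1 : ℕ) : ℝ) : ℂ)‖ = Real.log (n + 1 : ℕ) := by
    rw [Complex.norm_real, Real.norm_of_nonneg (Real.log_natCast_nonneg _)]
  rw [h3, one_div]
  have h4 : ‖χ ((n + 1 : ℕ) : ZMod q)‖ * Real.log ((n + 1 : ℕ) : ℝ) ≤ Real.log M := by
    calc _ ≤ 1 * Real.log ((n + 1 : ℕ) : ℝ) :=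
          mul_le_mul_of_nonneg_right (χ.norm_le_one _) (Real.log_natCast_nonneg _)
      _ ≤ _ := by rw [one_mul]; exact h2
  exact mul_le_mul h4 h1 (by positivity) (Real.log_natCast_nonneg M)

lemma approx_near {K : ℝ} (hK0 : 0 < K) (hK : ∀ (q : ℕ) [NeZero q] (χ : DirichletCharacter ℂ q), χ ≠ 1 →
    ∀ (s : ℂ), 1 / 4 < s.re → ∀ M : ℕ, ‖DirichletCharacter.LFunction χ s - PS χ M s‖ ≤
      K * q * (1 + ‖s‖) * ((M + 1 : ℕ) : ℝ) ^ (-(s.re - 1 / 4)))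
    (q : ℕ) [NeZero q] (χ : DirichletCharacter ℂ q) (hχ : χ ≠ 1) (s : ℂ) (hs : 3 / 4 ≤ s.re)
    (hs2 : ‖s‖ ≤ 3) :
    ‖DirichletCharacter.LFunction χ s - PS χ (q ^ 4) s‖ ≤ 4 * K / q := by
  have hq : (1 : ℝ) ≤ q := by exact_mod_cast NeZero.one_le
  refine (hK q χ hχ s (by linarith) (q ^ 4)).trans ?_
  have h1 : ((q ^ 4 + 1 : ℕ) : ℝ) ^ (-(s.re - 1 / 4)) ≤ ((q : ℝ) ^ 2)⁻¹ := by
    calc _ ≤ ((q ^ 4 + 1 : ℕ) : ℝ) ^ (-(1 / 2 : ℝ)) :=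
          Real.rpow_le_rpow_of_exponent_le (by push_cast; linarith [pow_nonneg (zero_le_one.trans hq) 4])
            (by linarith)
      _ ≤ (((q : ℝ) ^ 2) ^ (2 : ℝ)) ^ (-(1 / 2 : ℝ)) := by
          apply Real.rpow_le_rpow_of_nonpos (by positivity) _ (by norm_num)
          push_cast
          rw [Real.rpow_two]; ring_nf; linarith
      _ = _ := by
          rw [← Real.rpow_mul (by positivity)]; norm_num
          rw [Real.rpow_neg_one]
  calc _ ≤ K * q * (1 + 3) * ((q : ℝ) ^ 2)⁻¹ := by gcongr
    _ = _ := by field_simp; norm_num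

lemma LFunction_bounds : ∃ K : ℝ, 0 < K ∧ ∀ (q : ℕ) [NeZero q] (χ : DirichletCharacter ℂ q), χ ≠ 1 →
    ∀ σ : ℝ, 1 ≤ σ → σ ≤ 2 →
    ‖DirichletCharacter.LFunction χ σ - PS χ (q ^ 4) σ‖ ≤ K / q ∧
    ‖deriv (DirichletCharacter.LFunction χ) σ + PSd χ (q ^ 4) σ‖ ≤ K / q ∧
    ‖DirichletCharacter.LFunction χ σ‖ ≤ K * (1 + Real.log q) ∧
    ‖deriv (DirichletCharacter.LFunction χ) σ‖ ≤ K * (1 + Real.log q) ^ 2 := by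
  obtain ⟨K, hK0, hK⟩ := LFunction_approx
  refine ⟨16 * K + 20, by positivity, ?_⟩
  intro q _ χ hχ σ h1 h2
  have hq : (1 : ℝ) ≤ q := by exact_mod_cast NeZero.one_le
  have hl : 0 ≤ Real.log q := Real.log_nonneg hq
  have hlog : Real.log ((q ^ 4 : ℕ) : ℝ) = 4 * Real.log q := by
    push_cast; rw [Real.log_pow]; norm_num
  have A1 : ‖DirichletCharacter.LFunction χ σ - PS χ (q ^ 4) σ‖ ≤ 4 * K / q :=
    approx_near hK0 hK q χ hχ σ (by simp; linarith) (by
      rw [Complex.norm_real, Real.norm_of_nonneg (by linarith)]; linarith)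
  have A2 : ‖deriv (DirichletCharacter.LFunction χ) σ + PSd χ (q ^ 4) σ‖ ≤ 16 * K / q := by
    have hd : Differentiable ℂ (fun s => DirichletCharacter.LFunction χ s - PS χ (q ^ 4) s) :=
      (DirichletCharacter.differentiable_LFunction hχ).sub
        (fun s => (hasDerivAt_PS χ _ s).differentiableAt)
    have := Complex.norm_deriv_le_of_forall_mem_sphere_norm_le (c := (σ : ℂ)) (R := 1 / 4)
      (C := 4 * K / q) (by norm_num) hd.diffContOnCl (by
        intro z hz
        have hz' : ‖z - σ‖ = 1 / 4 := by simpa [dist_eq_norm] using hz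
        have hre : |(z - σ).re| ≤ 1 / 4 := hz' ▸ Complex.abs_re_le_norm _
        simp only [Complex.sub_re, Complex.ofReal_re] at hre
        have := abs_le.1 hre
        refine approx_near hK0 hK q χ hχ z (by linarith) ?_
        calc ‖z‖ = ‖(z - σ) + σ‖ := by ring_nf
          _ ≤ ‖z - σ‖ + ‖(σ : ℂ)‖ := norm_add_le _ _
          _ ≤ 3 := by
            rw [hz', Complex.norm_real, Real.norm_of_nonneg (by linarith)]; linarith)
    rw [((DirichletCharacter.differentiable_LFunction hχ σ).hasDerivAt.fun_sub
      (hasDerivAt_PS χ (q ^ 4) σ)).deriv, sub_neg_eq_add] at this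
    refine this.trans (le_of_eq ?_)
    ring
  have hKq : K / q ≤ K := div_le_self hK0.le hq
  have hdq : 4 * K / q = 4 * (K / q) := by ring
  have hdq2 : 16 * K / q = 16 * (K / q) := by ring
  have hKq0 : 0 ≤ K / q := by positivity
  refine ⟨?_, ?_, ?_, ?_⟩
  · refine A1.trans ?_
    gcongr; linarith
  · refine A2.trans ?_
    gcongr; linarith
  · have := norm_PS_le χ (q ^ 4) (σ : ℂ) (by simpa using h1)
    rw [hlog] at this
    have h3 := norm_add_le (DirichletCharacter.LFunction χ σ - PS χ (q ^ 4) σ) (PS χ (q ^ 4) σ)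
    rw [sub_add_cancel] at h3
    nlinarith
  · have := norm_PSd_le χ (q ^ 4) (σ : ℂ) (by simpa using h1)
    rw [hlog] at this
    have h3 := norm_sub_le (deriv (DirichletCharacter.LFunction χ) σ + PSd χ (q ^ 4) σ)
      (PSd χ (q ^ 4) σ)
    rw [add_sub_cancel_right] at h3
    nlinarith [mul_nonneg hK0.le hl, mul_nonneg (mul_nonneg hK0.le hl) hl]

lemma zeta_bound : ∃ Z : ℝ, 1 ≤ Z ∧ ∀ (q : ℕ) [NeZero q] (x : ℝ), 0 < x → x ≤ 1 →
    ‖DirichletCharacter.LFunctionTrivChar q (1 + x)‖ ≤ Z / x := by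
  have hc : ContinuousOn (DirichletCharacter.LFunctionTrivChar₁ 1) (Metric.closedBall 1 1) :=
    (DirichletCharacter.differentiable_LFunctionTrivChar₁ 1).continuous.continuousOn
  obtain ⟨Z, hZ⟩ := (isCompact_closedBall (1 : ℂ) 1).exists_bound_of_continuousOn hc
  refine ⟨max Z 1, le_max_right _ _, ?_⟩
  intro q _ x hx hx1
  have hne : (1 + x : ℂ) ≠ 1 := by
    simpa using hx.ne'
  have h1 := hZ (1 + x) (by simp [abs_of_pos hx, hx1])
  have h2 : DirichletCharacter.LFunctionTrivChar₁ 1 (1 + x) = x * riemannZeta (1 + x) := by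
    rw [DirichletCharacter.LFunctionTrivChar₁, Function.update_of_ne hne,
      DirichletCharacter.LFunctionTrivChar_eq_mul_riemannZeta hne]
    simp
  rw [h2, norm_mul, Complex.norm_real, Real.norm_of_nonneg hx.le] at h1
  rw [DirichletCharacter.LFunctionTrivChar_eq_mul_riemannZeta hne, norm_mul, norm_prod]
  have h3 : ∏ p ∈ q.primeFactors, ‖1 - (p : ℂ) ^ (-(1 + x : ℂ))‖ ≤ 1 := by
    apply prod_le_one
    · intros; positivity
    · intro p hp
      have hp1 : (1 : ℝ) ≤ p := by exact_mod_cast (Nat.prime_of_mem_primeFactors hp).one_le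
      have : (1 : ℂ) - (p : ℂ) ^ (-(1 + x : ℂ)) = ((1 - (p : ℝ) ^ (-(1 + x)) : ℝ) : ℂ) := by
        push_cast
        rw [Complex.ofReal_cpow (by positivity)]
        push_cast; rfl
      rw [this, Complex.norm_real, Real.norm_eq_abs, abs_le]
      have h5 : (p : ℝ) ^ (-(1 + x)) ≤ 1 := Real.rpow_le_one_of_one_le_of_nonpos hp1 (by linarith)
      have h6 : 0 ≤ (p : ℝ) ^ (-(1 + x)) := by positivity
      constructor <;> linarith
  rw [le_div_iff₀ hx]
  calc _ ≤ 1 * ‖riemannZeta (1 + x)‖ * x := by gcongr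
    _ = x * ‖riemannZeta (1 + x)‖ := by ring
    _ ≤ Z := h1
    _ ≤ _ := le_max_left _ _

/-- non-quadratic characters: lower bound of `L(1,χ)` by the 3-4-1 inequality. -/
lemma inv_L_complex : ∃ K : ℝ, 0 < K ∧ ∀ (q : ℕ) [NeZero q] (χ : DirichletCharacter ℂ q), χ ^ 2 ≠ 1 →
    ‖DirichletCharacter.LFunction χ 1‖⁻¹ ≤ K * (1 + Real.log q) ^ 7 := by
  obtain ⟨K0, hK00, hK0⟩ := LFunction_bounds
  obtain ⟨Z, hZ1, hZ⟩ := zeta_bound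
  set K := max K0 1 with hKdef
  have hK1 : 1 ≤ K := le_max_right _ _
  have hKK : K0 ≤ K := le_max_left _ _
  refine ⟨32 * Z ^ 3 * K ^ 4, by positivity, ?_⟩
  intro q _ χ hχ2
  have hχ : χ ≠ 1 := by rintro rfl; simp at hχ2
  set l := 1 + Real.log q with hl
  have hl1 : 1 ≤ l := one_le_ell
  set x : ℝ := (32 * Z ^ 3 * K ^ 5 * l ^ 9)⁻¹ with hx
  have hZp : 1 ≤ Z ^ 3 := one_le_pow₀ hZ1
  have hKp : 1 ≤ K ^ 5 := one_le_pow₀ hK1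
  have hlp : 1 ≤ l ^ 9 := one_le_pow₀ hl1
  have hx0 : 0 < x := by positivity
  have hx1 : x ≤ 1 := by
    apply inv_le_one_of_one_le₀
    have : 1 ≤ Z ^ 3 * K ^ 5 * l ^ 9 := one_le_mul_of_one_le_of_one_le (one_le_mul_of_one_le_of_one_le hZp hKp) hlp
    nlinarith
  have h1 := DirichletCharacter.norm_LFunction_product_ge_one χ hx0 0
  simp only [Complex.ofReal_zero, mul_zero, add_zero, norm_mul, norm_pow] at h1
  have hcast : (1 + x : ℂ) = ((1 + x : ℝ) : ℂ) := by push_cast; rfl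
  have b1 := hZ q x hx0 hx1
  have b3 : ‖DirichletCharacter.LFunction (χ ^ 2) (1 + x)‖ ≤ K * l := by
    rw [hcast]
    refine ((hK0 q (χ ^ 2) hχ2 (1 + x) (by linarith) (by linarith)).2.2.1).trans ?_
    gcongr
  have b2 : ‖DirichletCharacter.LFunction χ (1 + x)‖ ≤ ‖DirichletCharacter.LFunction χ 1‖ + K * l ^ 2 * x := by
    have := Convex.norm_image_sub_le_of_norm_hasDerivWithin_le (𝕜 := ℝ)
      (f := fun y : ℝ => DirichletCharacter.LFunction χ y)
      (f' := fun y : ℝ => deriv (DirichletCharacter.LFunction χ) y)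
      (s := Set.Icc (1 : ℝ) 2) (C := K * l ^ 2) (x := 1) (y := 1 + x) (by
        intro y hy
        exact ((DirichletCharacter.differentiable_LFunction hχ y).hasDerivAt.comp_ofReal).hasDerivWithinAt)
      (by
        intro y hy
        refine ((hK0 q χ hχ y hy.1 hy.2).2.2.2).trans ?_
        gcongr) (convex_Icc _ _) (by simp) ⟨by linarith, by linarith⟩
    have e : (1 + x - 1 : ℝ) = x := by ring
    rw [e, Real.norm_of_nonneg hx0.le] at this
    have h3 := norm_add_le (DirichletCharacter.LFunction χ ((1 + x : ℝ) : ℂ) - DirichletCharacter.LFunction χ ((1 : ℝ) : ℂ))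
      (DirichletCharacter.LFunction χ ((1 : ℝ) : ℂ))
    rw [sub_add_cancel] at h3
    rw [hcast]
    simp only [Complex.ofReal_one] at h3 this
    linarith
  set a := ‖DirichletCharacter.LFunction χ 1‖ with ha
  have ha0 : 0 ≤ a := norm_nonneg _
  have key : K * l ^ 2 * x < a := by
    by_contra hcon
    push Not at hcon
    have c1 : ‖DirichletCharacter.LFunction χ (1 + x)‖ ≤ 2 * (K * l ^ 2 * x) := by linarith
    have : (1 : ℝ) ≤ (Z / x) ^ 3 * (2 * (K * l ^ 2 * x)) ^ 4 * (K * l) := by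
      refine h1.le.trans ?_
      gcongr
    have e : (Z / x) ^ 3 * (2 * (K * l ^ 2 * x)) ^ 4 * (K * l) = (16 * Z ^ 3 * K ^ 5 * l ^ 9) * x := by
      field_simp; ring
    have e2 : (16 * Z ^ 3 * K ^ 5 * l ^ 9) * x = 1 / 2 := by
      rw [hx]; field_simp; norm_num
    rw [e, e2] at this
    norm_num at this
  have : K * l ^ 2 * x = (32 * Z ^ 3 * K ^ 4 * l ^ 7)⁻¹ := by
    rw [hx]; field_simp
  rw [this] at key
  calc a⁻¹ ≤ ((32 * Z ^ 3 * K ^ 4 * l ^ 7)⁻¹)⁻¹ := by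
        apply inv_anti₀ (by positivity) key.le
    _ = _ := by rw [inv_inv]

end TEC

namespace TEC
open Finset
open scoped ComplexOrder

lemma iter_inv (n : ℕ) : iteratedDeriv n (fun s : ℂ => (s - 1)⁻¹) 2 = (-1) ^ n * n.factorial := by
  have := congrFun (iter_deriv_inv_linear_sub n (1 : ℂ) 1) 2
  rw [iteratedDeriv_eq_iterate]
  simp only [one_mul] at this
  rw [this]
  norm_num

lemma choose_T (B : ℝ) (hB : 60 ≤ B) : ∃ T : ℕ, 1 ≤ T ∧ (4 / 5 : ℝ) ^ T ≤ B⁻¹ ∧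
    (T : ℝ) ≤ 6 * Real.log B := by
  have hlogB : 1 ≤ Real.log B := by
    rw [Real.le_log_iff_exp_le (by linarith)]
    linarith [Real.exp_one_lt_d9]
  have h5 : (1 / 5 : ℝ) ≤ Real.log (5 / 4) := by
    have := Real.one_sub_inv_le_log_of_pos (show (0:ℝ) < 5 / 4 by norm_num)
    norm_num at this ⊢
    exact this
  refine ⟨⌈5 * Real.log B⌉₊, ?_, ?_, ?_⟩
  · exact Nat.one_le_ceil_iff.2 (by linarith)
  · have hc := Nat.le_ceil (5 * Real.log B)
    set T := ⌈5 * Real.log B⌉₊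
    have : (4 / 5 : ℝ) ^ T = ((5 / 4 : ℝ) ^ T)⁻¹ := by rw [← inv_pow]; norm_num
    rw [this]
    apply inv_anti₀ (by linarith)
    rw [← Real.log_le_log_iff (by linarith) (by positivity), Real.log_pow]
    nlinarith
  · have := Nat.ceil_lt_add_one (show 0 ≤ 5 * Real.log B by linarith)
    linarith

lemma estermann : ∃ C0 : ℝ, 1 ≤ C0 ∧ ∀ (a : ℕ → ℂ) (H : ℂ → ℂ) (B : ℝ), 0 ≤ a → 1 ≤ (LSeries a 2).re →
    LSeries.abscissaOfAbsConv a < (2 : ℝ) → Differentiable ℂ H →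
    (∀ s : ℂ, 1 < s.re → LSeries a s = riemannZeta s * H s) → 1 ≤ B →
    (∀ s ∈ Metric.closedBall (2 : ℂ) (4 / 3), ‖H s‖ ≤ B) →
    ∀ σ : ℝ, 19 / 20 ≤ σ → σ < 1 →
    1 / 2 - ‖H 1‖ * (C0 * B) ^ (6 * (1 - σ)) / (1 - σ) ≤ (riemannZeta σ * H σ).re := by
  have hF1d := DirichletCharacter.differentiable_LFunctionTrivChar₁ 1
  obtain ⟨Z0, hZ0⟩ := (isCompact_closedBall (2 : ℂ) (4 / 3)).exists_bound_of_continuousOn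
    hF1d.continuous.continuousOn
  set Z := max Z0 1 with hZdef
  have hZ1 : 1 ≤ Z := le_max_right _ _
  refine ⟨60 * Z, by linarith, ?_⟩
  intro a H B ha h2 habs hH hser hB hHB σ hσ hσ1
  set F : ℂ → ℂ := fun s => DirichletCharacter.LFunctionTrivChar₁ 1 s * H s with hF
  have hFd : Differentiable ℂ F := hF1d.mul hH
  have hF1 : F 1 = H 1 := by simp [hF, DirichletCharacter.LFunctionTrivChar₁]
  have hFs : ∀ s : ℂ, s ≠ 1 → F s = (s - 1) * (riemannZeta s * H s) := by
    intro s hs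
    simp only [hF, DirichletCharacter.LFunctionTrivChar₁]
    rw [Function.update_of_ne hs, DirichletCharacter.LFunctionTrivChar_eq_mul_riemannZeta hs]
    simp; ring
  set g := dslope F 1 with hg
  have hgd : Differentiable ℂ g := by
    rw [← differentiableOn_univ]
    exact (Complex.differentiableOn_dslope Filter.univ_mem).2 hFd.differentiableOn
  have hgs : ∀ s : ℂ, s ≠ 1 → g s = riemannZeta s * H s - H 1 * (s - 1)⁻¹ := by
    intro s hs
    have hs' : s - 1 ≠ 0 := sub_ne_zero.2 hs
    rw [hg, dslope_of_ne _ hs, slope_def_field, hF1, hFs s hs]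
    field_simp
  have h1mem : (1 : ℂ) ∈ Metric.closedBall (2 : ℂ) (4 / 3) := by
    rw [Metric.mem_closedBall, dist_eq_norm]; norm_num
  have hgb : ∀ z ∈ Metric.sphere (2 : ℂ) (4 / 3), ‖g z‖ ≤ 6 * Z * B := by
    intro z hz
    have hz' : ‖z - 2‖ = 4 / 3 := by simpa [dist_eq_norm] using hz
    have hzc : z ∈ Metric.closedBall (2 : ℂ) (4 / 3) := Metric.sphere_subset_closedBall hz
    have hz1 : 1 / 3 ≤ ‖z - 1‖ := by
      have := norm_sub_le (z - 1) (1 : ℂ)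
      have e : z - 1 - 1 = z - 2 := by ring
      rw [e, hz'] at this
      simp at this
      linarith
    have hne : z ≠ 1 := by rintro rfl; simp at hz1; linarith
    rw [hg, dslope_of_ne _ hne, slope_def_field, norm_div, div_le_iff₀ (by linarith)]
    have b1 : ‖F z‖ ≤ Z * B := by
      simp only [hF, norm_mul]
      exact mul_le_mul ((hZ0 z hzc).trans (le_max_left _ _)) (hHB z hzc) (norm_nonneg _) (by linarith)
    have b2 : ‖F 1‖ ≤ Z * B := by
      rw [hF1]
      refine (hHB 1 h1mem).trans ?_
      nlinarith
    have b3 := norm_sub_le (F z) (F 1)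
    have : 0 ≤ Z * B := by positivity
    nlinarith
  have hcoef : ∀ n : ℕ, iteratedDeriv n g 2 = iteratedDeriv n (LSeries a) 2 - H 1 * ((-1) ^ n * n.factorial) := by
    intro n
    have hnh : {z : ℂ | 1 < z.re} ∈ nhds (2 : ℂ) :=
      (isOpen_lt continuous_const Complex.continuous_re).mem_nhds (by simp)
    have hev : g =ᶠ[nhds 2] (LSeries a - fun s => H 1 * (s - 1)⁻¹) := by
      filter_upwards [hnh] with z hz
      have hne : z ≠ 1 := by rintro rfl; simp at hz
      rw [hgs z hne, Pi.sub_apply, hser z hz]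
    have hc1 : ContDiffAt ℂ n (fun s : ℂ => (s - 1)⁻¹) 2 := by
      apply ContDiffAt.inv
      · exact contDiffAt_id.sub contDiffAt_const
      · norm_num
    have hc2 : ContDiffAt ℂ n (LSeries a) 2 := by
      apply AnalyticAt.contDiffAt
      exact LSeries_analyticOnNhd a 2 (by simpa using habs)
    rw [hev.iteratedDeriv_eq, iteratedDeriv_sub hc2 (contDiffAt_const.mul hc1),
      iteratedDeriv_const_mul_field, iter_inv]
  obtain ⟨T, hT1, hT2, hT3⟩ := choose_T (60 * Z * B) (by nlinarith)
  -- Taylor series at σ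
  have hdist : dist (σ : ℂ) 2 = 2 - σ := by
    rw [dist_eq_norm]
    have : (σ : ℂ) - 2 = ((σ - 2 : ℝ) : ℂ) := by push_cast; rfl
    rw [this, Complex.norm_real, Real.norm_eq_abs, abs_of_neg (by linarith)]; ring
  have htay := Complex.hasSum_taylorSeries_on_ball (f := g) (c := 2) (r := 4 / 3)
    hgd.differentiableOn (z := (σ : ℂ)) (by rw [Metric.mem_ball, hdist]; linarith)
  set u : ℕ → ℂ := fun n => ((n.factorial : ℂ))⁻¹ • ((σ : ℂ) - 2) ^ n • iteratedDeriv n g 2 with hu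
  have hub : ∀ n, ‖u n‖ ≤ 6 * Z * B * (4 / 5) ^ n := by
    intro n
    have h := Complex.norm_iteratedDeriv_le_of_forall_mem_sphere_norm_le n (by norm_num : (0:ℝ) < 4/3)
      hgd.diffContOnCl hgb
    simp only [hu, norm_smul, norm_inv, norm_pow, Complex.norm_natCast]
    rw [← dist_eq_norm, hdist]
    have hfac : (0 : ℝ) < n.factorial := by positivity
    calc _ ≤ ((n.factorial : ℝ))⁻¹ * ((2 - σ) ^ n * (n.factorial * (6 * Z * B) / (4 / 3) ^ n)) := by
          have : 0 ≤ 2 - σ := by linarith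
          gcongr
      _ = 6 * Z * B * ((2 - σ) / (4 / 3)) ^ n := by
          rw [div_pow (2 - σ) (4 / 3) n]
          have hw : (0 : ℝ) < (4 / 3) ^ n := by positivity
          generalize (4 / 3 : ℝ) ^ n = w at hw ⊢
          generalize (2 - σ) ^ n = v
          field_simp
      _ ≤ _ := by
          have h0 : 0 ≤ (2 - σ) / (4 / 3) := by
            apply div_nonneg <;> linarith
          exact mul_le_mul_of_nonneg_left (pow_le_pow_left₀ h0
            (by rw [div_le_iff₀ (by norm_num)]; linarith) n) (by positivity)
  have hur : ∀ n, (u n).re = (2 - σ) ^ n * (((-1 : ℂ) ^ n * iteratedDeriv n (LSeries a) 2).re / n.factorial)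
      - (H 1).re * (2 - σ) ^ n := by
    intro n
    have hfac : (n.factorial : ℂ) ≠ 0 := by exact_mod_cast n.factorial_ne_zero
    have e1 : ((σ : ℂ) - 2) ^ n = (-1) ^ n * (((2 - σ) ^ n : ℝ) : ℂ) := by
      push_cast; rw [← mul_pow]; congr 1; ring
    have e2 : ((-1 : ℂ)) ^ n * (-1) ^ n = 1 := by rw [← mul_pow]; simp
    have : u n = (((2 - σ) ^ n : ℝ) : ℂ) * (((((n.factorial : ℝ))⁻¹ : ℝ) : ℂ) *
        ((-1 : ℂ) ^ n * iteratedDeriv n (LSeries a) 2)) - H 1 * (((2 - σ) ^ n : ℝ) : ℂ) := by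
      simp only [hu, smul_eq_mul, hcoef, e1]
      push_cast
      field_simp
      linear_combination (- (2 - (σ:ℂ)) ^ n * H 1 * (n.factorial : ℂ)) * e2
    rw [this, Complex.sub_re, Complex.re_ofReal_mul, Complex.re_ofReal_mul, Complex.re_mul_ofReal]
    ring
  have hbn : ∀ n, 0 ≤ ((-1 : ℂ) ^ n * iteratedDeriv n (LSeries a) 2).re := by
    intro n
    have := LSeries.iteratedDeriv_alternating ha (x := 2) habs n
    exact (Complex.le_def.1 (by simpa using this)).1
  have hure := Complex.hasSum_re htay
  have hsplit := hure.summable.sum_add_tsum_nat_add T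
  rw [hure.tsum_eq] at hsplit
  have hgeo : HasSum (fun n : ℕ => 6 * Z * B * (4 / 5 : ℝ) ^ (n + T)) (30 * Z * B * (4 / 5) ^ T) := by
    have := (hasSum_geometric_of_lt_one (by norm_num : (0:ℝ) ≤ 4/5) (by norm_num)).mul_left (6 * Z * B * (4 / 5) ^ T)
    have e1 : (fun n : ℕ => 6 * Z * B * (4 / 5 : ℝ) ^ (n + T)) =
        fun n : ℕ => 6 * Z * B * (4 / 5) ^ T * (4 / 5 : ℝ) ^ n := by
      funext n; rw [pow_add]; ring
    have e2 : 30 * Z * B * (4 / 5 : ℝ) ^ T = 6 * Z * B * (4 / 5) ^ T * (1 - 4 / 5 : ℝ)⁻¹ := by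
      norm_num; ring
    rw [e1, e2]
    exact this
  have htail : |∑' n, (u (n + T)).re| ≤ 30 * Z * B * (4 / 5) ^ T := by
    rw [← Real.norm_eq_abs]
    refine tsum_of_norm_bounded hgeo fun n => ?_
    exact (Complex.abs_re_le_norm _).trans (hub _)
  have htail2 : 30 * Z * B * (4 / 5) ^ T ≤ 1 / 2 := by
    have h60 : (0:ℝ) < 60 * Z * B := by positivity
    calc 30 * Z * B * (4 / 5) ^ T ≤ 30 * Z * B * (60 * Z * B)⁻¹ := by gcongr
      _ = 1 / 2 := by field_simp; norm_num
  have hfin : 1 - (H 1).re * (((2 - σ) ^ T - 1) / (1 - σ)) ≤ ∑ n ∈ range T, (u n).re := by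
    have hg1 : ∑ n ∈ range T, (2 - σ) ^ n = ((2 - σ) ^ T - 1) / (1 - σ) := by
      rw [geom_sum_eq (by linarith)]; congr 1; ring
    simp_rw [hur]
    rw [sum_sub_distrib, ← mul_sum, hg1]
    have : (1 : ℝ) ≤ ∑ n ∈ range T, (2 - σ) ^ n * (((-1 : ℂ) ^ n * iteratedDeriv n (LSeries a) 2).re / n.factorial) := by
      have h0 : (0 : ℕ) ∈ range T := mem_range.2 (by omega)
      refine le_trans ?_ (single_le_sum (f := fun n => (2 - σ) ^ n * (((-1 : ℂ) ^ n * iteratedDeriv n (LSeries a) 2).re / n.factorial)) (fun n _ => ?_) h0)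
      · simpa using h2
      · have := hbn n
        have h3 : 0 ≤ 2 - σ := by linarith
        positivity
    linarith
  have hne : (σ : ℂ) ≠ 1 := by
    intro h; have : σ = 1 := by exact_mod_cast h
    linarith
  have hgσ : (g σ).re = (riemannZeta σ * H σ).re + (H 1).re / (1 - σ) := by
    rw [hgs _ hne, Complex.sub_re]
    have : ((σ : ℂ) - 1)⁻¹ = (((σ - 1)⁻¹ : ℝ) : ℂ) := by push_cast; rfl
    rw [this, Complex.re_mul_ofReal]
    have h3 : (σ - 1)⁻¹ = - (1 - σ)⁻¹ := by rw [← inv_neg]; congr 1; ring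
    rw [h3]; ring
  have h1σ : 0 < 1 - σ := by linarith
  have hpow : (2 - σ) ^ T ≤ (60 * Z * B) ^ (6 * (1 - σ)) := by
    have h60 : (0:ℝ) < 60 * Z * B := by positivity
    have e1 : 2 - σ ≤ Real.exp (1 - σ) := by linarith [Real.add_one_le_exp (1 - σ)]
    calc (2 - σ) ^ T ≤ (Real.exp (1 - σ)) ^ T := by
          have : 0 ≤ 2 - σ := by linarith
          gcongr
      _ = Real.exp (T * (1 - σ)) := by rw [← Real.exp_nat_mul]
      _ ≤ Real.exp (Real.log (60 * Z * B) * (6 * (1 - σ))) := by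
          apply Real.exp_le_exp.2; nlinarith
      _ = _ := by rw [Real.rpow_def_of_pos h60]
  have hH1 : (H 1).re * (2 - σ) ^ T / (1 - σ) ≤ ‖H 1‖ * (60 * Z * B) ^ (6 * (1 - σ)) / (1 - σ) := by
    have h3 : 0 ≤ (2 - σ) ^ T := pow_nonneg (by linarith) _
    gcongr
    exact Complex.re_le_norm _
  have hexp : (H 1).re * (((2 - σ) ^ T - 1) / (1 - σ)) = (H 1).re * (2 - σ) ^ T / (1 - σ) - (H 1).re / (1 - σ) := by
    ring
  have := (abs_le.1 htail).1
  linarith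

end TEC

namespace TEC
open Finset
open scoped ComplexOrder

/-- arithmetic function of a character -/
noncomputable def cf {q : ℕ} (χ : DirichletCharacter ℂ q) : ArithmeticFunction ℂ :=
  toArithmeticFunction (χ ·)

lemma cf_apply {q : ℕ} (χ : DirichletCharacter ℂ q) {n : ℕ} (hn : n ≠ 0) : cf χ n = χ n := by
  simp [cf, toArithmeticFunction, hn]

lemma cf_mult {q : ℕ} (χ : DirichletCharacter ℂ q) : (cf χ).IsMultiplicative :=
  DirichletCharacter.isMultiplicative_toArithmeticFunction χ

lemma cf_summable {q : ℕ} (χ : DirichletCharacter ℂ q) {s : ℂ} (hs : 1 < s.re) :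
    LSeriesSummable (fun n => cf χ n) s := by
  refine LSeriesSummable_of_bounded_of_one_lt_re (m := 1) (fun n hn => ?_) hs
  rw [cf_apply χ hn]
  exact χ.norm_le_one _

lemma cf_LSeries {q : ℕ} [NeZero q] (χ : DirichletCharacter ℂ q) {s : ℂ} (hs : 1 < s.re) :
    LSeries (fun n => cf χ n) s = DirichletCharacter.LFunction χ s := by
  rw [DirichletCharacter.LFunction_eq_LSeries χ hs]
  exact LSeries_congr (fun {n} hn => cf_apply χ hn) s

lemma mul_prime_pow' (f g : ArithmeticFunction ℂ) {p : ℕ} (hp : p.Prime) (k : ℕ) :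
    (f * g) (p ^ k) = ∑ i ∈ range (k + 1), f (p ^ i) * g (p ^ (k - i)) := by
  rw [mul_apply, Nat.sum_divisorsAntidiagonal (fun a b => f a * g b), Nat.sum_divisors_prime_pow hp]
  refine sum_congr rfl fun i hi => ?_
  rw [Nat.pow_div (by simp at hi; omega) hp.pos]

lemma zeta_pp {p : ℕ} (hp : p.Prime) (k : ℕ) : (zeta : ArithmeticFunction ℂ) (p ^ k) = 1 := by
  simp [natCoe_apply, zeta_apply, hp.ne_zero]

lemma nn_geom {x : ℂ} (hx : x = 0 ∨ x = 1 ∨ x = -1) (k : ℕ) : 0 ≤ ∑ i ∈ range (k + 1), x ^ i := by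
  rcases hx with rfl | rfl | rfl
  · exact sum_nonneg fun i _ => pow_nonneg le_rfl _
  · exact sum_nonneg fun i _ => pow_nonneg zero_le_one _
  · rw [neg_one_geom_sum]; split_ifs
    exacts [le_rfl, zero_le_one]

lemma nn_pp (f1 f2 f3 : ArithmeticFunction ℂ) {p : ℕ} (hp : p.Prime) (x y : ℂ)
    (h1 : ∀ k, f1 (p ^ k) = x ^ k) (h2 : ∀ k, f2 (p ^ k) = y ^ k) (h3 : ∀ k, f3 (p ^ k) = (x * y) ^ k)
    (hx : x = 0 ∨ x = 1 ∨ x = -1) (hxy : y = 0 ∨ y = 1 ∨ (x = -1 ∧ y = -1)) (k : ℕ) :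
    0 ≤ ((zeta : ArithmeticFunction ℂ) * f1 * (f2 * f3)) (p ^ k) := by
  have hA : ∀ j, 0 ≤ ((zeta : ArithmeticFunction ℂ) * f1) (p ^ j) := by
    intro j
    rw [mul_comm, mul_prime_pow' _ _ hp]
    simp_rw [zeta_pp hp, h1, mul_one]
    exact nn_geom hx j
  have hB : ∀ j, 0 ≤ (f2 * f3) (p ^ j) := by
    intro j
    rw [mul_comm, mul_prime_pow' _ _ hp]
    simp_rw [h2, h3]
    rcases hxy with rfl | rfl | ⟨rfl, rfl⟩
    · refine sum_nonneg fun i _ => ?_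
      rw [mul_zero]
      exact mul_nonneg (pow_nonneg le_rfl _) (pow_nonneg le_rfl _)
    · simpa using nn_geom hx j
    · have : ∀ i, (-1 * -1 : ℂ) ^ i = 1 := by intro i; norm_num
      simp_rw [this, one_mul]
      have h := sum_range_reflect (fun i => (-1 : ℂ) ^ i) (j + 1)
      simp only [Nat.add_sub_cancel] at h
      rw [h]
      exact nn_geom (by simp) j
  rw [mul_prime_pow' _ _ hp]
  exact sum_nonneg fun i _ => mul_nonneg (hA _) (hB _)

lemma nonneg_of_pp {f : ArithmeticFunction ℂ} (hf : f.IsMultiplicative)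
    (h : ∀ p k : ℕ, p.Prime → 0 ≤ f (p ^ k)) (n : ℕ) : 0 ≤ f n := by
  rcases eq_or_ne n 0 with rfl | hn
  · simp
  · rw [hf.multiplicative_factorization _ hn]
    exact prod_nonneg fun p hp => h p _ (Nat.prime_of_mem_primeFactors hp)

/-- product character -/
noncomputable def psi {q r : ℕ} (χ1 : DirichletCharacter ℂ q) (χ2 : DirichletCharacter ℂ r) :
    DirichletCharacter ℂ (q * r) :=
  DirichletCharacter.changeLevel (dvd_mul_right q r) χ1 *
    DirichletCharacter.changeLevel (dvd_mul_left r q) χ2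

lemma psi_apply {q r : ℕ} (χ1 : DirichletCharacter ℂ q) (χ2 : DirichletCharacter ℂ r) (n : ℕ) :
    psi χ1 χ2 n = χ1 n * χ2 n := by
  by_cases h : Nat.Coprime n (q * r)
  · have e1 := DirichletCharacter.changeLevel_eq_cast_of_dvd χ1 (dvd_mul_right q r) (ZMod.unitOfCoprime n h)
    have e2 := DirichletCharacter.changeLevel_eq_cast_of_dvd χ2 (dvd_mul_left r q) (ZMod.unitOfCoprime n h)
    simp only [ZMod.coe_unitOfCoprime, dvd_mul_right, dvd_mul_left, ZMod.cast_natCast] at e1 e2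
    rw [psi, MulChar.mul_apply, e1, e2]
  · rw [MulChar.map_nonunit _ (by rwa [ZMod.isUnit_iff_coprime])]
    rw [Nat.coprime_mul_iff_right, not_and_or] at h
    rcases h with h | h
    · rw [MulChar.map_nonunit χ1 (by rwa [ZMod.isUnit_iff_coprime]), zero_mul]
    · rw [MulChar.map_nonunit χ2 (by rwa [ZMod.isUnit_iff_coprime]), mul_zero]

lemma psi_ne_one {q r : ℕ} [NeZero q] [NeZero r] (χ1 : DirichletCharacter ℂ q) (χ2 : DirichletCharacter ℂ r)
    (h1 : χ1 ≠ 1) (hqr : Nat.Coprime q r) : psi χ1 χ2 ≠ 1 := by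
  intro h
  have h2 : χ1.changeLevel (q.dvd_mul_right r) = (χ2⁻¹).changeLevel (r.dvd_mul_left q) := by
    rw [map_inv]
    exact eq_inv_of_mul_eq_one_left h
  have h3 := DirichletCharacter.factorsThrough_gcd χ1 (χ2⁻¹) h2
  rw [hqr.gcd_eq_one] at h3
  exact h1 ((DirichletCharacter.factorsThrough_one_iff χ1).1 h3)

lemma quad_val {q : ℕ} {χ : DirichletCharacter ℂ q} (h : χ ^ 2 = 1) (n : ℕ) : χ n = 0 ∨ χ n = 1 ∨ χ n = -1 :=
  MulChar.isQuadratic_iff_sq_eq_one.mpr h n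

/-- the Siegel quartic convolution -/
noncomputable def quart {q r : ℕ} (χ1 : DirichletCharacter ℂ q) (χ2 : DirichletCharacter ℂ r) : ArithmeticFunction ℂ :=
  (zeta : ArithmeticFunction ℂ) * cf χ1 * (cf χ2 * cf (psi χ1 χ2))

lemma quart_mult {q r : ℕ} (χ1 : DirichletCharacter ℂ q) (χ2 : DirichletCharacter ℂ r) :
    (quart χ1 χ2).IsMultiplicative :=
  (isMultiplicative_zeta.natCast.mul (cf_mult _)).mul ((cf_mult _).mul (cf_mult _))

lemma quart_nonneg {q r : ℕ} (χ1 : DirichletCharacter ℂ q) (χ2 : DirichletCharacter ℂ r)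
    (h1 : χ1 ^ 2 = 1) (h2 : χ2 ^ 2 = 1) (n : ℕ) : 0 ≤ quart χ1 χ2 n := by
  refine nonneg_of_pp (quart_mult χ1 χ2) (fun p k hp => ?_) n
  have hp0 : ∀ k, p ^ k ≠ 0 := fun k => pow_ne_zero _ hp.ne_zero
  have e1 : ∀ k, cf χ1 (p ^ k) = χ1 p ^ k := fun k => by
    rw [cf_apply _ (hp0 k), Nat.cast_pow, map_pow]
  have e2 : ∀ k, cf χ2 (p ^ k) = χ2 p ^ k := fun k => by
    rw [cf_apply _ (hp0 k), Nat.cast_pow, map_pow]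
  have e3 : ∀ k, cf (psi χ1 χ2) (p ^ k) = (χ1 p * χ2 p) ^ k := fun k => by
    rw [cf_apply _ (hp0 k), psi_apply, Nat.cast_pow, Nat.cast_pow, map_pow, map_pow, mul_pow]
  have e3' : ∀ k, cf (psi χ1 χ2) (p ^ k) = (χ2 p * χ1 p) ^ k := fun k => by
    rw [e3, mul_comm]
  by_cases hc : χ2 p = 0 ∨ χ2 p = 1 ∨ (χ1 p = -1 ∧ χ2 p = -1)
  · exact nn_pp _ _ _ hp _ _ e1 e2 e3 (quad_val h1 p) hc k
  · have : quart χ1 χ2 = (zeta : ArithmeticFunction ℂ) * cf χ2 * (cf χ1 * cf (psi χ1 χ2)) := by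
      rw [quart]; ring
    rw [this]
    refine nn_pp _ _ _ hp _ _ e2 e1 e3' (quad_val h2 p) ?_ k
    have := quad_val h1 p
    have := quad_val h2 p
    tauto

lemma quart_summable {q r : ℕ} (χ1 : DirichletCharacter ℂ q) (χ2 : DirichletCharacter ℂ r)
    {s : ℂ} (hs : 1 < s.re) : LSeriesSummable (fun n => quart χ1 χ2 n) s :=
  LSeriesSummable_mul (LSeriesSummable_mul (LSeriesSummable_zeta_iff.mpr hs) (cf_summable _ hs))
    (LSeriesSummable_mul (cf_summable _ hs) (cf_summable _ hs))

lemma quart_LSeries {q r : ℕ} [NeZero q] [NeZero r] (χ1 : DirichletCharacter ℂ q) (χ2 : DirichletCharacter ℂ r)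
    {s : ℂ} (hs : 1 < s.re) : LSeries (fun n => quart χ1 χ2 n) s = riemannZeta s *
      (DirichletCharacter.LFunction χ1 s * (DirichletCharacter.LFunction χ2 s *
        DirichletCharacter.LFunction (psi χ1 χ2) s)) := by
  have hz : LSeriesSummable (fun n => (zeta : ArithmeticFunction ℂ) n) s := LSeriesSummable_zeta_iff.mpr hs
  rw [quart, LSeries_mul' (LSeriesSummable_mul hz (cf_summable _ hs))
    (LSeriesSummable_mul (cf_summable _ hs) (cf_summable _ hs)), LSeries_mul' hz (cf_summable _ hs),
    LSeries_mul' (cf_summable _ hs) (cf_summable _ hs), cf_LSeries _ hs, cf_LSeries _ hs, cf_LSeries _ hs]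
  have : LSeries (fun n => (zeta : ArithmeticFunction ℂ) n) s = riemannZeta s := by
    exact LSeries_zeta_eq_riemannZeta hs
  rw [this]; ring

lemma zm_LSeries {q : ℕ} [NeZero q] (χ : DirichletCharacter ℂ q)
    {s : ℂ} (hs : 1 < s.re) : LSeries (fun n => χ.zetaMul n) s = riemannZeta s *
      DirichletCharacter.LFunction χ s := by
  have hz : LSeriesSummable (fun n => (zeta : ArithmeticFunction ℂ) n) s := LSeriesSummable_zeta_iff.mpr hs
  have : LSeries (fun n => (zeta : ArithmeticFunction ℂ) n) s = riemannZeta s := by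
    exact LSeries_zeta_eq_riemannZeta hs
  rw [← this, ← cf_LSeries _ hs, ← LSeries_mul' hz (cf_summable _ hs)]; rfl

lemma abscissa_lt_two {a : ℕ → ℂ} (h : ∀ s : ℂ, 1 < s.re → LSeriesSummable a s) :
    LSeries.abscissaOfAbsConv a < (2 : ℝ) := by
  refine (LSeries.abscissaOfAbsConv_le_of_forall_lt_LSeriesSummable' (x := (3/2 : ℝ)) ?_).trans_lt ?_
  · intro y hy
    refine h _ ?_
    have : (3 / 2 : ℝ) < y := by exact_mod_cast hy
    simp; linarith
  · exact_mod_cast (by norm_num : (3/2 : ℝ) < 2)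

lemma one_le_LSeries_two {a : ℕ → ℂ} (h : ∀ s : ℂ, 1 < s.re → LSeriesSummable a s) (ha : 0 ≤ a) (h1 : a 1 = 1) :
    1 ≤ (LSeries a 2).re := by
  have hs := h 2 (by simp)
  have hn : ∀ n, 0 ≤ LSeries.term a 2 n := fun n => by
    have := LSeries.term_nonneg (ha n) 2
    simpa using this
  have h2 : LSeries.term a 2 1 ≤ LSeries a 2 :=
    Summable.le_tsum hs 1 (fun n _ => hn n)
  rw [LSeries.term_of_ne_zero one_ne_zero, h1] at h2
  have := (Complex.le_def.1 h2).1
  simpa using this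

end TEC

namespace TEC
open Finset
open scoped ComplexOrder

lemma L_ball : ∃ K : ℝ, 1 ≤ K ∧ ∀ (q : ℕ) [NeZero q] (χ : DirichletCharacter ℂ q), χ ≠ 1 →
    ∀ s ∈ Metric.closedBall (2 : ℂ) (4 / 3), ‖DirichletCharacter.LFunction χ s‖ ≤ K * q := by
  obtain ⟨K, hK, h⟩ := LFunction_approx
  refine ⟨5 * K + 1, by linarith, ?_⟩
  intro q _ χ hχ s hs
  have hs' : ‖s - 2‖ ≤ 4 / 3 := by simpa [dist_eq_norm] using hs
  have hre : 2 / 3 ≤ s.re := by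
    have := (abs_le.1 ((Complex.abs_re_le_norm (s - 2)).trans hs')).1
    simp at this; linarith
  have hn : ‖s‖ ≤ 10 / 3 := by
    have := norm_add_le (s - 2) 2
    simp at this; linarith
  have := h q χ hχ s (by linarith) 0
  simp [PS] at this
  have hq : (0:ℝ) ≤ q := by positivity
  have : ‖DirichletCharacter.LFunction χ s‖ ≤ K * q * (1 + 10 / 3) :=
    this.trans (by gcongr)
  nlinarith

lemma one_add_log_le (ε : ℝ) (hε : 0 < ε) (x : ℝ) (hx : 1 ≤ x) :
    1 + Real.log x ≤ (1 + 1 / ε) * x ^ ε := by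
  have h1 := Real.log_le_rpow_div (show 0 ≤ x by linarith) hε
  have h2 := Real.one_le_rpow hx hε.le
  have : (1 + 1 / ε) * x ^ ε = x ^ ε + x ^ ε / ε := by ring
  linarith

lemma zeta_neg : ∃ δ : ℝ, 0 < δ ∧ ∀ σ : ℝ, 1 - δ < σ → σ < 1 → (riemannZeta σ).re < 0 := by
  have hF1d := (DirichletCharacter.differentiable_LFunctionTrivChar₁ 1).continuous
  have hc : Continuous fun σ : ℝ => (DirichletCharacter.LFunctionTrivChar₁ 1 (σ : ℂ)).re :=
    Complex.continuous_re.comp (hF1d.comp Complex.continuous_ofReal)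
  have h1 : (DirichletCharacter.LFunctionTrivChar₁ 1 ((1:ℝ) : ℂ)).re = 1 := by
    simp [DirichletCharacter.LFunctionTrivChar₁]
  have hev : ∀ᶠ σ : ℝ in nhds (1 : ℝ), 0 < (DirichletCharacter.LFunctionTrivChar₁ 1 (σ : ℂ)).re :=
    (hc.continuousAt (x := 1)).eventually (lt_mem_nhds (by show (0:ℝ) < (DirichletCharacter.LFunctionTrivChar₁ 1 ((1:ℝ) : ℂ)).re; rw [h1]; norm_num))
  obtain ⟨δ, hδ, h⟩ := Metric.eventually_nhds_iff.1 hev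
  refine ⟨δ, hδ, fun σ h2 h3 => ?_⟩
  have h4 := h (y := σ) (by rw [Real.dist_eq, abs_lt]; constructor <;> linarith)
  have hs : (σ : ℂ) ≠ 1 := by
    intro h; have : σ = 1 := by exact_mod_cast h
    linarith
  simp only [DirichletCharacter.LFunctionTrivChar₁] at h4
  rw [Function.update_of_ne hs, DirichletCharacter.LFunctionTrivChar_eq_mul_riemannZeta hs] at h4
  have e : ((σ : ℂ) - 1) = ((σ - 1 : ℝ) : ℂ) := by push_cast; rfl
  simp only [Nat.primeFactors_one, prod_empty, one_mul] at h4
  rw [e, Complex.re_ofReal_mul] at h4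
  by_contra hcon
  push Not at hcon
  nlinarith

lemma L_real {q : ℕ} [NeZero q] (χ : DirichletCharacter ℂ q) (h2 : χ ^ 2 = 1) (h1 : χ ≠ 1) (σ : ℝ) (hσ : 1 / 2 ≤ σ) :
    (DirichletCharacter.LFunction χ σ).im = 0 := by
  obtain ⟨K, hK, h⟩ := LFunction_approx
  have hPS : ∀ M, (PS χ M σ).im = 0 := by
    intro M
    rw [PS, Complex.im_sum]
    refine sum_eq_zero fun n _ => ?_
    have e : (((n + 1 : ℕ) : ℂ)) ^ (-(σ : ℂ)) = ((((n + 1 : ℕ) : ℝ) ^ (-σ) : ℝ) : ℂ) := by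
      rw [Complex.ofReal_cpow (by positivity)]; push_cast; rfl
    rw [e]
    rcases quad_val h2 (n + 1) with h | h | h <;> rw [h] <;> simp only [zero_mul, one_mul, neg_mul,
      Complex.ofReal_im, Complex.neg_im, Complex.zero_im, neg_zero]
  have hb : ∀ M : ℕ, |(DirichletCharacter.LFunction χ σ).im| ≤ K * q * (1 + ‖(σ:ℂ)‖) * ((M + 1 : ℕ) : ℝ) ^ (-(σ - 1 / 4)) := by
    intro M
    have := h q χ h1 σ (by simp; linarith) M
    refine le_trans ?_ (this.trans (by simp))
    have h3 := Complex.abs_im_le_norm (DirichletCharacter.LFunction χ σ - PS χ M σ)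
    rwa [Complex.sub_im, hPS, sub_zero] at h3
  have ht : Filter.Tendsto (fun M : ℕ => K * q * (1 + ‖(σ:ℂ)‖) * ((M + 1 : ℕ) : ℝ) ^ (-(σ - 1 / 4)))
      Filter.atTop (nhds (K * q * (1 + ‖(σ:ℂ)‖) * 0)) := by
    refine Filter.Tendsto.const_mul _ ?_
    have := (tendsto_rpow_neg_atTop (show 0 < σ - 1 / 4 by linarith)).comp
      ((tendsto_natCast_atTop_atTop (R := ℝ)).comp (Filter.tendsto_add_atTop_nat 1))
    exact this
  rw [mul_zero] at ht
  have := ge_of_tendsto' ht hb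
  exact abs_nonpos_iff.1 this

lemma L_pos {q : ℕ} [NeZero q] (χ : DirichletCharacter ℂ q) (h2 : χ ^ 2 = 1) (h1 : χ ≠ 1) (σ : ℝ) (hσ : 1 / 2 ≤ σ)
    (hσ1 : σ < 1) (hnz : ∀ β : ℝ, σ ≤ β → β < 1 → DirichletCharacter.LFunction χ β ≠ 0) :
    0 ≤ (DirichletCharacter.LFunction χ σ).re := by
  by_contra hcon
  push Not at hcon
  have hc : Continuous fun σ : ℝ => (DirichletCharacter.LFunction χ (σ : ℂ)).re :=
    Complex.continuous_re.comp ((DirichletCharacter.differentiable_LFunction h1).continuous.comp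
      Complex.continuous_ofReal)
  have hL2 : 0 < (DirichletCharacter.LFunction χ ((2 : ℝ) : ℂ)).re := by
    have hp := LSeries.positive (a := fun n => χ.zetaMul n) (fun n => DirichletCharacter.zetaMul_nonneg h2 n)
      (by rw [χ.isMultiplicative_zetaMul.map_one]; exact zero_lt_one) (x := 2)
      (abscissa_lt_two fun s hs => χ.LSeriesSummable_zetaMul hs)
    rw [zm_LSeries χ (by simp)] at hp
    have h3 := (Complex.lt_def.1 hp).1
    have e : riemannZeta ((2 : ℝ) : ℂ) = ((Real.pi ^ 2 / 6 : ℝ) : ℂ) := by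
      have := riemannZeta_two
      push_cast; exact this
    rw [e, Complex.re_ofReal_mul] at h3
    have : 0 < Real.pi ^ 2 / 6 := by positivity
    simp only [Complex.zero_re] at h3
    exact pos_of_mul_pos_right h3 this.le
  obtain ⟨β, hβ, hβ0⟩ := intermediate_value_Icc (show σ ≤ 2 by linarith) hc.continuousOn
    (show (0:ℝ) ∈ Set.Icc _ _ from ⟨hcon.le, hL2.le⟩)
  have h0 : DirichletCharacter.LFunction χ β = 0 := by
    apply Complex.ext
    · exact hβ0
    · exact L_real χ h2 h1 β (hσ.trans hβ.1)
  rcases lt_or_ge β 1 with h | h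
  · exact hnz β hβ.1 h h0
  · exact DirichletCharacter.LFunction_ne_zero_of_one_le_re χ (Or.inl h1) (by simpa using h) h0

lemma siegel (ε : ℝ) (hε : 0 < ε) : ∃ C : ℝ, 0 < C ∧ ∀ (q : ℕ) [NeZero q] (χ : DirichletCharacter ℂ q), q.Prime →
    χ ^ 2 = 1 → χ ≠ 1 → ‖DirichletCharacter.LFunction χ 1‖⁻¹ ≤ C * (q : ℝ) ^ ε := by
  obtain ⟨C0, hC0, hE⟩ := estermann
  obtain ⟨K, hK, hball⟩ := L_ball
  obtain ⟨K5, hK5, hLb⟩ := LFunction_bounds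
  obtain ⟨δ, hδ, hζ⟩ := zeta_neg
  obtain ⟨e, he0, he1, he2, he3⟩ : ∃ e : ℝ, 0 < e ∧ 24 * e ≤ ε ∧ e ≤ 1 / 20 ∧ e < δ := by
    refine ⟨min (ε / 24) (min (1 / 20) (δ / 2)), by positivity, ?_, ?_, ?_⟩
    · have := min_le_left (ε / 24) (min (1 / 20) (δ / 2)); linarith
    · exact (min_le_right _ _).trans (min_le_left _ _)
    · exact ((min_le_right _ _).trans (min_le_right _ _)).trans_lt (by linarith)
  by_cases hA : ∃ (q1 : ℕ) (_ : NeZero q1) (χ1 : DirichletCharacter ℂ q1) (β : ℝ), q1.Prime ∧ χ1 ^ 2 = 1 ∧ χ1 ≠ 1 ∧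
      1 - e ≤ β ∧ β < 1 ∧ DirichletCharacter.LFunction χ1 β = 0
  · obtain ⟨q1, _, χ1, β, hq1, h12, h11, hβ, hβ1, hz⟩ := hA
    -- the level q1 constant
    set C1 : ℝ := ∑ χ : DirichletCharacter ℂ q1, ‖DirichletCharacter.LFunction χ 1‖⁻¹ with hC1
    have hC1n : 0 ≤ C1 := sum_nonneg fun _ _ => by positivity
    set u := 6 * (1 - β) with hu
    have hu0 : 0 < u := by rw [hu]; linarith
    have hu1 : 2 * u ≤ ε / 2 := by rw [hu]; linarith
    set C2 : ℝ := 2 / (1 - β) * (K5 * (1 + Real.log q1)) * (K5 * ((1 + 1 / (ε / 2)) * (q1 : ℝ) ^ (ε / 2))) *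
      (C0 * (K ^ 3 * q1 ^ 2)) ^ u with hC2
    have h1β : 0 < 1 - β := by linarith
    have hq1r : (1:ℝ) ≤ q1 := by exact_mod_cast hq1.one_le
    have hlq1 : 0 ≤ Real.log q1 := Real.log_nonneg hq1r
    have hC2n : 0 ≤ C2 := by positivity
    refine ⟨C1 + C2 + 1, by linarith, ?_⟩
    intro q _ χ hq h2 h1
    have hqr : (1:ℝ) ≤ q := by exact_mod_cast hq.one_le
    have hqe : 1 ≤ (q : ℝ) ^ ε := Real.one_le_rpow hqr hε.le
    by_cases hqq : q1 = q
    · subst hqq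
      have : ‖DirichletCharacter.LFunction χ 1‖⁻¹ ≤ C1 :=
        single_le_sum (f := fun χ : DirichletCharacter ℂ q1 => ‖DirichletCharacter.LFunction χ 1‖⁻¹)
          (fun _ _ => by positivity) (mem_univ χ)
      nlinarith
    · have hcop : Nat.Coprime q1 q := (Nat.coprime_primes hq1 hq).2 hqq
      have hψ := psi_ne_one χ1 χ h11 hcop
      set ψ := psi χ1 χ with hψd
      have hdiff : Differentiable ℂ (fun s => DirichletCharacter.LFunction χ1 s * (DirichletCharacter.LFunction χ s *
        DirichletCharacter.LFunction ψ s)) :=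
        (DirichletCharacter.differentiable_LFunction h11).mul ((DirichletCharacter.differentiable_LFunction h1).mul
          (DirichletCharacter.differentiable_LFunction hψ))
      have hnn : (0 : ℕ → ℂ) ≤ fun n => quart χ1 χ n := fun n => quart_nonneg χ1 χ h12 h2 n
      have hsm : ∀ s : ℂ, 1 < s.re → LSeriesSummable (fun n => quart χ1 χ n) s := fun s hs => quart_summable χ1 χ hs
      have hB1 : 1 ≤ K ^ 3 * q1 ^ 2 * (q:ℝ) ^ 2 :=
        one_le_mul_of_one_le_of_one_le (one_le_mul_of_one_le_of_one_le (one_le_pow₀ hK) (one_le_pow₀ hq1r)) (one_le_pow₀ hqr)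
      have hE1 := hE (fun n => quart χ1 χ n) _ (K ^ 3 * q1 ^ 2 * (q:ℝ) ^ 2) hnn
        (one_le_LSeries_two hsm hnn (quart_mult χ1 χ).map_one) (abscissa_lt_two hsm) hdiff
        (fun s hs => quart_LSeries χ1 χ hs) hB1 (by
          intro s hs
          have b1 := hball q1 χ1 h11 s hs
          have b2 := hball q χ h1 s hs
          have b3 := hball (q1 * q) ψ hψ s hs
          push_cast at b3
          rw [norm_mul, norm_mul]
          calc _ ≤ (K * q1) * ((K * q) * (K * (q1 * q))) := by gcongr
            _ = _ := by ring) β (by linarith) hβ1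
      rw [hz] at hE1
      simp only [zero_mul, mul_zero, Complex.zero_re, norm_mul] at hE1
      have b1 := (hLb q1 χ1 h11 1 le_rfl (by norm_num)).2.2.1
      have b3 := (hLb (q1 * q) ψ hψ 1 le_rfl (by norm_num)).2.2.1
      simp only [Complex.ofReal_one] at b1 b3
      have b4 := one_add_log_le (ε / 2) (by linarith) ((q1 * q : ℕ) : ℝ) (by push_cast; nlinarith)
      have b5 : ((q1 * q : ℕ) : ℝ) ^ (ε / 2) = (q1 : ℝ) ^ (ε / 2) * (q : ℝ) ^ (ε / 2) := by
        push_cast; rw [Real.mul_rpow (by positivity) (by positivity)]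
      have b6 : (C0 * (K ^ 3 * q1 ^ 2 * (q:ℝ) ^ 2)) ^ u ≤ (C0 * (K ^ 3 * q1 ^ 2)) ^ u * (q:ℝ) ^ (ε / 2) := by
        rw [show C0 * (K ^ 3 * q1 ^ 2 * (q:ℝ) ^ 2) = (C0 * (K ^ 3 * q1 ^ 2)) * (q:ℝ) ^ (2:ℝ) by
          rw [Real.rpow_two]; ring, Real.mul_rpow (by positivity) (by positivity), ← Real.rpow_mul (by positivity)]
        gcongr
      have b7 : (q:ℝ) ^ ε = (q : ℝ) ^ (ε / 2) * (q : ℝ) ^ (ε / 2) := by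
        rw [← Real.rpow_add (by linarith)]; ring_nf
      have hLne : 0 < ‖DirichletCharacter.LFunction χ 1‖ :=
        norm_pos_iff.2 (DirichletCharacter.LFunction_apply_one_ne_zero h1)
      set x := ‖DirichletCharacter.LFunction χ 1‖ with hx
      have key : 1 / 2 ≤ x * (C2 * (q:ℝ) ^ ε / 2) := by
        calc (1/2:ℝ) ≤ ‖DirichletCharacter.LFunction χ1 1‖ * (x * ‖DirichletCharacter.LFunction ψ 1‖) *
              (C0 * (K ^ 3 * q1 ^ 2 * (q:ℝ) ^ 2)) ^ u / (1 - β) := by linarith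
          _ ≤ (K5 * (1 + Real.log q1)) * (x * (K5 * ((1 + 1 / (ε / 2)) * ((q1 : ℝ) ^ (ε / 2) * (q : ℝ) ^ (ε / 2))))) *
              ((C0 * (K ^ 3 * q1 ^ 2)) ^ u * (q:ℝ) ^ (ε / 2)) / (1 - β) := by
              rw [b5] at b4
              have b8 : ‖DirichletCharacter.LFunction ψ 1‖ ≤ K5 * ((1 + 1 / (ε / 2)) * ((q1 : ℝ) ^ (ε / 2) * (q : ℝ) ^ (ε / 2))) :=
                b3.trans (by gcongr)
              gcongr
          _ = _ := by rw [hC2, b7]; ring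
      have : x⁻¹ ≤ C2 * (q:ℝ) ^ ε := by
        rw [inv_le_iff_one_le_mul₀ hLne]; linarith
      nlinarith
  · push Not at hA
    set σ := 1 - e with hσ
    set u := 6 * (1 - σ) with hu
    have hu0 : 0 < u := by rw [hu]; linarith
    have hu1 : u ≤ ε := by rw [hu]; linarith
    have h1β : 0 < 1 - σ := by linarith
    refine ⟨2 / (1 - σ) * (C0 * K) ^ u, by positivity, ?_⟩
    intro q _ χ hq h2 h1
    have hqr : (1:ℝ) ≤ q := by exact_mod_cast hq.one_le
    have hpos := L_pos χ h2 h1 σ (by linarith) (by linarith) (fun β hb1 hb2 => hA q inferInstance χ β hq h2 h1 hb1 hb2)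
    have hre := L_real χ h2 h1 σ (by linarith)
    have hnn : (0 : ℕ → ℂ) ≤ fun n => χ.zetaMul n := fun n => DirichletCharacter.zetaMul_nonneg h2 n
    have hsm : ∀ s : ℂ, 1 < s.re → LSeriesSummable (fun n => χ.zetaMul n) s := fun s hs => χ.LSeriesSummable_zetaMul hs
    have hE1 := hE (fun n => χ.zetaMul n) _ (K * q) hnn
        (one_le_LSeries_two hsm hnn χ.isMultiplicative_zetaMul.map_one) (abscissa_lt_two hsm)
        (DirichletCharacter.differentiable_LFunction h1)
        (fun s hs => zm_LSeries χ hs) (one_le_mul_of_one_le_of_one_le hK hqr) (fun s hs => hball q χ h1 s hs) σ (by linarith) (by linarith)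
    have hzn := hζ σ (by linarith) (by linarith)
    rw [Complex.mul_re, hre, mul_zero, sub_zero] at hE1
    have hle : (riemannZeta σ).re * (DirichletCharacter.LFunction χ σ).re ≤ 0 :=
      mul_nonpos_of_nonpos_of_nonneg hzn.le hpos
    have hLne : 0 < ‖DirichletCharacter.LFunction χ 1‖ :=
        norm_pos_iff.2 (DirichletCharacter.LFunction_apply_one_ne_zero h1)
    set x := ‖DirichletCharacter.LFunction χ 1‖ with hx
    rw [inv_le_iff_one_le_mul₀ hLne]
    have b6 : (C0 * (K * q)) ^ u ≤ (C0 * K) ^ u * (q:ℝ) ^ ε := by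
      rw [← mul_assoc, Real.mul_rpow (by positivity) (by positivity)]
      gcongr
    have : x * (C0 * (K * q)) ^ u / (1 - σ) ≤ x * ((C0 * K) ^ u * (q:ℝ) ^ ε) / (1 - σ) := by gcongr
    have e2 : 2 / (1 - σ) * (C0 * K) ^ u * (q:ℝ) ^ ε * x = 2 * (x * ((C0 * K) ^ u * (q:ℝ) ^ ε) / (1 - σ)) := by ring
    rw [e2]
    linarith

lemma rpow_add_log (ε : ℝ) (hε : 0 < ε) (k : ℕ) : ∃ C : ℝ, 0 < C ∧ ∀ x : ℝ, 1 ≤ x →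
    (1 + Real.log x) ^ k ≤ C * x ^ ε := by
  rcases Nat.eq_zero_or_pos k with rfl | hk
  · exact ⟨1, one_pos, fun x hx => by simpa using Real.one_le_rpow hx hε.le⟩
  have hk' : (0:ℝ) < k := by exact_mod_cast hk
  refine ⟨(1 + 1 / (ε / k)) ^ k, by positivity, fun x hx => ?_⟩
  have h := one_add_log_le (ε / k) (by positivity) x hx
  have h0 := Real.log_nonneg hx
  calc (1 + Real.log x) ^ k ≤ ((1 + 1 / (ε / k)) * x ^ (ε / k)) ^ k := by gcongr
    _ = _ := by
      rw [mul_pow, ← Real.rpow_natCast (x ^ (ε / k)), ← Real.rpow_mul (by linarith), div_mul_cancel₀ _ hk'.ne']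

lemma inv_L (ε : ℝ) (hε : 0 < ε) : ∃ C : ℝ, 0 < C ∧ ∀ (q : ℕ) [NeZero q] (χ : DirichletCharacter ℂ q), q.Prime →
    χ ≠ 1 → ‖DirichletCharacter.LFunction χ 1‖⁻¹ ≤ C * (q : ℝ) ^ ε := by
  obtain ⟨C1, h1, hs⟩ := siegel ε hε
  obtain ⟨K, hK, hc⟩ := inv_L_complex
  obtain ⟨C2, h2, hl⟩ := rpow_add_log ε hε 7
  refine ⟨C1 + K * C2, by positivity, ?_⟩
  intro q _ χ hq hχ
  have hqr : (1:ℝ) ≤ q := by exact_mod_cast hq.one_le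
  have hp : 0 < (q:ℝ) ^ ε := by positivity
  by_cases h : χ ^ 2 = 1
  · refine (hs q χ hq h hχ).trans ?_
    gcongr
    have := mul_pos hK h2
    linarith
  · refine (hc q χ h).trans ?_
    calc K * (1 + Real.log q) ^ 7 ≤ K * (C2 * q ^ ε) := by gcongr; exact hl q hqr
      _ ≤ _ := by nlinarith

end TEC

namespace TEC
open Finset

lemma inner_le (w : ℕ → ℝ) (hw0 : ∀ n, 0 ≤ w n) (hw : ∀ m n, 1 ≤ m → m ≤ n → w n ≤ w m) (q R n : ℕ) (hq : 1 ≤ q) :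
    ∑ m ∈ (range R).filter (fun m => n < m ∧ m ≡ n [MOD q]), w m ≤ ∑ j ∈ range R, w (q * (j + 1)) := by
  set s := (range R).filter (fun m => n < m ∧ m ≡ n [MOD q]) with hs
  have key : ∀ m ∈ s, ∃ j, m = n + q * (j + 1) := by
    intro m hm
    simp only [hs, mem_filter, mem_range] at hm
    obtain ⟨c, hc⟩ := (Nat.modEq_iff_dvd' hm.2.1.le).1 hm.2.2.symm
    refine ⟨c - 1, ?_⟩
    have : c ≠ 0 := by rintro rfl; simp at hc; omega
    rw [Nat.sub_add_cancel (by omega)]; omega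
  choose! j hj using key
  have hinj : Set.InjOn j s := by
    intro a ha b hb h
    rw [hj a ha, hj b hb, h]
  calc ∑ m ∈ s, w m ≤ ∑ m ∈ s, w (q * (j m + 1)) := by
        refine sum_le_sum fun m hm => ?_
        apply hw
        · nlinarith
        · have := hj m hm; omega
    _ = ∑ i ∈ s.image j, w (q * (i + 1)) := by rw [sum_image hinj]
    _ ≤ _ := by
        refine sum_le_sum_of_subset_of_nonneg ?_ fun _ _ _ => hw0 _
        intro i hi
        obtain ⟨m, hm, rfl⟩ := mem_image.1 hi
        have h1 := hj m hm
        simp only [hs, mem_filter, mem_range] at hm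
        rw [mem_range]
        nlinarith

lemma half_pairs (w : ℕ → ℝ) (hw0 : ∀ n, 0 ≤ w n) (hw : ∀ m n, 1 ≤ m → m ≤ n → w n ≤ w m) (q R : ℕ) (hq : 1 ≤ q) :
    ∑ n ∈ range R, ∑ m ∈ range R, (if (n < m ∧ m ≡ n [MOD q]) ∧ n ≠ 0 then w m * w n else 0) ≤
    (∑ n ∈ range R, w (n + 1)) * (∑ j ∈ range R, w (q * (j + 1))) := by
  have hS : 0 ≤ ∑ j ∈ range R, w (q * (j + 1)) := sum_nonneg fun _ _ => hw0 _
  calc _ ≤ ∑ n ∈ range R, (if n ≠ 0 then w n else 0) * (∑ j ∈ range R, w (q * (j + 1))) := by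
        refine sum_le_sum fun n _ => ?_
        split_ifs with h
        · simp only [h, not_false_eq_true, and_true, ne_eq]
          rw [← sum_filter, ← sum_mul, mul_comm]
          exact mul_le_mul_of_nonneg_left (inner_le w hw0 hw q R n hq) (hw0 _)
        · simp [h]
    _ = (∑ n ∈ range R, (if n ≠ 0 then w n else 0)) * (∑ j ∈ range R, w (q * (j + 1))) := by rw [sum_mul]
    _ ≤ _ := by
        refine mul_le_mul_of_nonneg_right ?_ hS
        cases R with
        | zero => simp
        | succ R =>
          rw [sum_range_succ', sum_range_succ]
          simp only [ne_eq, Nat.add_eq_zero_iff, one_ne_zero, and_false, not_false_eq_true, if_true, not_true_eq_false, if_false, add_zero]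
          linarith [hw0 (R + 1)]

lemma pairs (w : ℕ → ℝ) (hw0 : ∀ n, 0 ≤ w n) (hw : ∀ m n, 1 ≤ m → m ≤ n → w n ≤ w m) (q R : ℕ) (hq : 1 ≤ q) :
    ∑ m ∈ range R, ∑ n ∈ range R, (if m ≡ n [MOD q] ∧ m ≠ n ∧ m ≠ 0 ∧ n ≠ 0 then w m * w n else 0) ≤
    2 * ((∑ n ∈ range R, w (n + 1)) * (∑ j ∈ range R, w (q * (j + 1)))) := by
  have h := half_pairs w hw0 hw q R hq
  have h' := h
  rw [sum_comm] at h'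
  have : ∑ m ∈ range R, ∑ n ∈ range R, (if m ≡ n [MOD q] ∧ m ≠ n ∧ m ≠ 0 ∧ n ≠ 0 then w m * w n else 0) ≤
    ∑ m ∈ range R, ∑ n ∈ range R, ((if (n < m ∧ m ≡ n [MOD q]) ∧ n ≠ 0 then w m * w n else 0) +
      (if (m < n ∧ n ≡ m [MOD q]) ∧ m ≠ 0 then w n * w m else 0)) := by
    refine sum_le_sum fun m _ => sum_le_sum fun n _ => ?_
    have hmn := mul_nonneg (hw0 m) (hw0 n)
    have hmn' := mul_nonneg (hw0 n) (hw0 m)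
    by_cases hc : m ≡ n [MOD q] ∧ m ≠ n ∧ m ≠ 0 ∧ n ≠ 0
    · rw [if_pos hc]
      obtain ⟨h1, h2, h3, h4⟩ := hc
      rcases lt_or_gt_of_ne h2 with h5 | h5
      · rw [if_neg (c := (n < m ∧ m ≡ n [MOD q]) ∧ n ≠ 0) (by omega), if_pos ⟨⟨h5, h1.symm⟩, h3⟩]; linarith
      · rw [if_pos ⟨⟨h5, h1⟩, h4⟩]
        split_ifs <;> linarith
    · rw [if_neg hc]
      split_ifs <;> linarith
  simp_rw [sum_add_distrib] at this
  linarith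

lemma orth {q : ℕ} [NeZero q] (hq : q.Prime) (m n : ℕ) :
    ∑ χ : DirichletCharacter ℂ q, χ m * (starRingEnd ℂ) (χ n) =
      if m ≡ n [MOD q] ∧ ¬ q ∣ m then ((q : ℂ) - 1) else 0 := by
  by_cases hn : q ∣ n
  · have h0 : (n : ZMod q) = 0 := (ZMod.natCast_eq_zero_iff n q).2 hn
    have hne : ¬ (m ≡ n [MOD q] ∧ ¬ q ∣ m) := by
      rintro ⟨h1, h2⟩
      exact h2 ((h1.dvd_iff dvd_rfl).2 hn)
    rw [if_neg hne]
    have : Fact (1 < q) := ⟨hq.one_lt⟩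
    refine sum_eq_zero fun χ _ => ?_
    rw [h0, MulChar.map_zero]; simp
  · have hu : IsUnit (n : ZMod q) := by
      rw [ZMod.isUnit_iff_coprime]
      exact ((Nat.Prime.coprime_iff_not_dvd hq).2 hn).symm
    have h := DirichletCharacter.sum_char_inv_mul_char_eq ℂ hu (m : ZMod q)
    have e : ∀ χ : DirichletCharacter ℂ q, χ m * (starRingEnd ℂ) (χ n) = χ (n : ZMod q)⁻¹ * χ m := by
      intro χ
      have hf : Fact q.Prime := ⟨hq⟩
      rw [mul_comm, starRingEnd_apply, MulChar.star_apply', MulChar.inv_apply']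
    simp_rw [e]
    rw [h, Nat.totient_prime hq, Nat.cast_sub hq.one_le]
    have : ((n : ZMod q) = m) ↔ m ≡ n [MOD q] ∧ ¬ q ∣ m := by
      rw [ZMod.natCast_eq_natCast_iff]
      refine ⟨fun h => ⟨h.symm, fun h2 => hn ((h.dvd_iff dvd_rfl).2 h2)⟩, fun h => h.1.symm⟩
    simp only [this, Nat.cast_one]


/-- Dirichlet polynomial at 1 twisted by a character -/
noncomputable def Dl {q : ℕ} (χ : DirichletCharacter ℂ q) (f : ArithmeticFunction ℝ) : ℂ :=
  LSeries (fun n => χ n * (f n : ℂ)) 1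

/-- finitely supported below R -/
def SuppLT (f : ArithmeticFunction ℝ) (R : ℕ) : Prop := ∀ n, R ≤ n → f n = 0

lemma term_one (a : ℕ → ℂ) (n : ℕ) : LSeries.term a 1 n = if n = 0 then 0 else a n / n := by
  simp [LSeries.term_def]

lemma Dl_hasSum {q : ℕ} (χ : DirichletCharacter ℂ q) {f : ArithmeticFunction ℝ} {R : ℕ} (hf : SuppLT f R) :
    HasSum (LSeries.term (fun n => χ n * (f n : ℂ)) 1) (∑ n ∈ range R, χ n * ((f n / n : ℝ) : ℂ)) := by
  have : ∑ n ∈ range R, χ n * ((f n / n : ℝ) : ℂ) = ∑ n ∈ range R, LSeries.term (fun n => χ n * (f n : ℂ)) 1 n := by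
    refine sum_congr rfl fun n _ => ?_
    rw [term_one]
    split_ifs with h
    · simp [h]
    · push_cast; ring
  rw [this]
  refine hasSum_sum_of_ne_finset_zero fun n hn => ?_
  rw [term_one, hf n (by simpa using hn)]
  simp

lemma Dl_eq {q : ℕ} (χ : DirichletCharacter ℂ q) {f : ArithmeticFunction ℝ} {R : ℕ} (hf : SuppLT f R) :
    Dl χ f = ∑ n ∈ range R, χ n * ((f n / n : ℝ) : ℂ) := (Dl_hasSum χ hf).tsum_eq

lemma SuppLT.mul {f g : ArithmeticFunction ℝ} {R S : ℕ} (hf : SuppLT f R) (hg : SuppLT g S) : SuppLT (f * g) (R * S) := by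
  intro n hn
  rw [mul_apply]
  refine sum_eq_zero fun p hp => ?_
  have h1 := (Nat.mem_divisorsAntidiagonal.1 hp).1
  have h2 := (Nat.mem_divisorsAntidiagonal.1 hp).2
  by_cases h : R ≤ p.1
  · rw [hf _ h, zero_mul]
  · by_cases h' : S ≤ p.2
    · rw [hg _ h', mul_zero]
    · push Not at h h'
      exfalso
      have : p.1 * p.2 < R * S := Nat.mul_lt_mul'' h h'
      omega

lemma Dl_mul {q : ℕ} (χ : DirichletCharacter ℂ q) {f g : ArithmeticFunction ℝ} {R S : ℕ}
    (hf : SuppLT f R) (hg : SuppLT g S) : Dl χ (f * g) = Dl χ f * Dl χ g := by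
  rw [Dl, Dl, Dl, ← LSeries_convolution' (Dl_hasSum χ hf).summable (Dl_hasSum χ hg).summable]
  congr 1
  have := DirichletCharacter.mul_convolution_distrib χ (fun n => (f n : ℂ)) (fun n => (g n : ℂ))
  refine Eq.trans ?_ this.symm
  funext n
  simp only [Pi.mul_apply]
  congr 1
  rw [LSeries.convolution_def, mul_apply]
  push_cast
  rfl

lemma Dl_sq {q : ℕ} [NeZero q] (hq : q.Prime) {f : ArithmeticFunction ℝ} {R : ℕ} (hf : SuppLT f R) :
    ∑ χ : DirichletCharacter ℂ q, ‖Dl χ f‖ ^ 2 = ((q : ℝ) - 1) * ∑ m ∈ range R, ∑ n ∈ range R,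
      if m ≡ n [MOD q] ∧ ¬ q ∣ m then f m / m * (f n / n) else 0 := by
  have h : (((∑ χ : DirichletCharacter ℂ q, ‖Dl χ f‖ ^ 2 : ℝ)) : ℂ) = ((((q : ℝ) - 1) * ∑ m ∈ range R, ∑ n ∈ range R,
      if m ≡ n [MOD q] ∧ ¬ q ∣ m then f m / m * (f n / n) else 0 : ℝ) : ℂ) := by
    rw [Complex.ofReal_sum]
    have e : ∀ χ : DirichletCharacter ℂ q, ((‖Dl χ f‖ ^ 2 : ℝ) : ℂ) = ∑ m ∈ range R, ∑ n ∈ range R,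
        (χ m * (starRingEnd ℂ) (χ n)) * (((f m / m * (f n / n) : ℝ)) : ℂ) := by
      intro χ
      rw [← Complex.normSq_eq_norm_sq, ← Complex.mul_conj, Dl_eq χ hf, map_sum, sum_mul_sum]
      refine sum_congr rfl fun m _ => sum_congr rfl fun n _ => ?_
      rw [map_mul, Complex.conj_ofReal]
      push_cast; ring
    simp_rw [e]
    rw [sum_comm]
    simp_rw [sum_comm (s := (univ : Finset (DirichletCharacter ℂ q))), ← sum_mul, orth hq]
    push_cast
    rw [mul_sum]
    refine sum_congr rfl fun m _ => ?_
    rw [mul_sum]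
    refine sum_congr rfl fun n _ => ?_
    split_ifs <;> simp
  exact_mod_cast h

lemma half_inv (n : ℕ) : ∑ j ∈ range n, ((j + 1 : ℕ) : ℝ)⁻¹ ≤ 1 + Real.log n := by
  simpa using harm_le n

lemma pairs_log (q R : ℕ) (hq : 1 ≤ q) :
    ∑ m ∈ range R, ∑ n ∈ range R, (if m ≡ n [MOD q] ∧ m ≠ n ∧ m ≠ 0 ∧ n ≠ 0 then (m : ℝ)⁻¹ * (n : ℝ)⁻¹ else 0) ≤
    2 * (1 + Real.log R) ^ 2 / q := by
  refine (pairs (fun n => (n : ℝ)⁻¹) (fun n => by positivity) (fun m n h1 h2 => ?_) q R hq).trans ?_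
  · have : (0:ℝ) < m := by exact_mod_cast h1
    exact inv_anti₀ this (by exact_mod_cast h2)
  · have h0 : (0:ℝ) < q := by exact_mod_cast hq
    have h := half_inv R
    have h1 : 0 ≤ ∑ j ∈ range R, ((j + 1 : ℕ) : ℝ)⁻¹ := sum_nonneg fun _ _ => by positivity
    have e : ∑ j ∈ range R, (((q * (j + 1) : ℕ)) : ℝ)⁻¹ = (q : ℝ)⁻¹ * ∑ j ∈ range R, ((j + 1 : ℕ) : ℝ)⁻¹ := by
      rw [mul_sum]; refine sum_congr rfl fun j _ => ?_
      rw [Nat.cast_mul, mul_inv]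
    rw [e]
    calc _ = 2 * (∑ j ∈ range R, ((j + 1 : ℕ) : ℝ)⁻¹) ^ 2 / q := by ring
      _ ≤ _ := by gcongr

lemma offdiag {q : ℕ} (hq : 1 ≤ q) {f : ArithmeticFunction ℝ} {R : ℕ} {K : ℝ} (hK : ∀ n, n < R → |f n| ≤ K) :
    |∑ m ∈ range R, ∑ n ∈ range R, (if (m ≡ n [MOD q] ∧ ¬ q ∣ m) ∧ m ≠ n then f m / m * (f n / n) else 0)| ≤
      K ^ 2 * (2 * (1 + Real.log R) ^ 2 / q) := by
  refine le_trans ?_ (mul_le_mul_of_nonneg_left (pairs_log q R hq) (sq_nonneg K))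
  refine (abs_sum_le_sum_abs _ _).trans ?_
  rw [mul_sum]
  refine sum_le_sum fun m hm => ?_
  refine (abs_sum_le_sum_abs _ _).trans ?_
  rw [mul_sum]
  refine sum_le_sum fun n hn => ?_
  rw [mem_range] at hm hn
  have hK0 : 0 ≤ K := (abs_nonneg _).trans (hK m hm)
  have hm0 : (0:ℝ) ≤ (m:ℝ)⁻¹ * (n:ℝ)⁻¹ := by positivity
  have hmn : |f m / m * (f n / n)| ≤ K ^ 2 * ((m:ℝ)⁻¹ * (n:ℝ)⁻¹) := by
    rw [abs_mul, abs_div, abs_div, Nat.abs_cast, Nat.abs_cast]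
    calc _ ≤ K / m * (K / n) := by gcongr; exacts [hK m hm, hK n hn]
      _ = _ := by ring
  by_cases h0 : m = 0 ∨ n = 0
  · have : f m / m * (f n / n) = 0 := by rcases h0 with rfl | rfl <;> simp
    simp only [this, ite_self, abs_zero]
    split_ifs <;> positivity
  push Not at h0
  by_cases hc : (m ≡ n [MOD q] ∧ ¬ q ∣ m) ∧ m ≠ n
  · rw [if_pos hc, if_pos ⟨hc.1.1, hc.2, h0.1, h0.2⟩]
    exact hmn
  · rw [if_neg hc, abs_zero]
    split_ifs <;> positivity

lemma split_diag {q : ℕ} {f : ArithmeticFunction ℝ} {R : ℕ} :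
    ∑ m ∈ range R, ∑ n ∈ range R, (if m ≡ n [MOD q] ∧ ¬ q ∣ m then f m / m * (f n / n) else 0) =
    (∑ m ∈ range R, if ¬ q ∣ m then (f m) ^ 2 / (m : ℝ) ^ 2 else 0) +
    ∑ m ∈ range R, ∑ n ∈ range R, (if (m ≡ n [MOD q] ∧ ¬ q ∣ m) ∧ m ≠ n then f m / m * (f n / n) else 0) := by
  rw [← sum_add_distrib]
  refine sum_congr rfl fun m hm => ?_
  have : (if ¬ q ∣ m then (f m) ^ 2 / (m : ℝ) ^ 2 else 0) =
      ∑ n ∈ range R, if m = n then (if ¬ q ∣ m then (f m) ^ 2 / (m : ℝ) ^ 2 else 0) else 0 := by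
    rw [sum_ite_eq, if_pos hm]
  rw [this, ← sum_add_distrib]
  refine sum_congr rfl fun n _ => ?_
  by_cases h : m = n
  · subst h
    simp only [Nat.ModEq.refl, true_and, if_true, ne_eq, not_true_eq_false, and_false, if_false, add_zero]
    split_ifs <;> ring
  · simp [h]

end TEC

namespace TEC
open Finset

/-- truncation -/
noncomputable def tr (N : ℕ) (f : ArithmeticFunction ℝ) : ArithmeticFunction ℝ :=
  ⟨fun n => if n ≤ N then f n else 0, by simp⟩

lemma tr_apply (N : ℕ) (f : ArithmeticFunction ℝ) (n : ℕ) : tr N f n = if n ≤ N then f n else 0 := rfl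

lemma tr_supp (N : ℕ) (f : ArithmeticFunction ℝ) : SuppLT (tr N f) (N + 1) := by
  intro n hn; rw [tr_apply, if_neg (by omega)]

lemma tr_mul (N : ℕ) (f g : ArithmeticFunction ℝ) (n : ℕ) (hn : n ≤ N) : (tr N f * tr N g) n = (f * g) n := by
  rw [mul_apply, mul_apply]
  refine sum_congr rfl fun p hp => ?_
  have h1 := (Nat.mem_divisorsAntidiagonal.1 hp).1
  have h2 := (Nat.mem_divisorsAntidiagonal.1 hp).2
  have h3 : p.1 ≤ n := Nat.le_of_dvd (by omega) ⟨p.2, h1.symm⟩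
  have h4 : p.2 ≤ n := Nat.le_of_dvd (by omega) ⟨p.1, by rw [mul_comm]; exact h1.symm⟩
  rw [tr_apply, tr_apply, if_pos (by omega), if_pos (by omega)]

lemma mul_mono {f g f' g' : ArithmeticFunction ℝ} (hf : ∀ n, 0 ≤ f n) (hg : ∀ n, 0 ≤ g n)
    (hf' : ∀ n, f n ≤ f' n) (hg' : ∀ n, g n ≤ g' n) (n : ℕ) : 0 ≤ (f * g) n ∧ (f * g) n ≤ (f' * g') n := by
  rw [mul_apply, mul_apply]
  exact ⟨sum_nonneg fun p _ => mul_nonneg (hf _) (hg _),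
    sum_le_sum fun p _ => mul_le_mul (hf' _) (hg' _) (hg _) ((hf _).trans (hf' _))⟩

lemma tr_bd (N : ℕ) {f : ArithmeticFunction ℝ} (hf : ∀ n, 0 ≤ f n) (n : ℕ) : 0 ≤ tr N f n ∧ tr N f n ≤ f n := by
  rw [tr_apply]; split_ifs
  · exact ⟨hf n, le_rfl⟩
  · exact ⟨le_rfl, hf n⟩

lemma zeta_nn (n : ℕ) : 0 ≤ ((zeta : ArithmeticFunction ℝ)) n := by
  rw [natCoe_apply]; positivity

lemma af_sub (f g : ArithmeticFunction ℝ) (n : ℕ) : (f - g) n = f n - g n := by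
  rw [eq_sub_iff_add_eq, ← ArithmeticFunction.add_apply, sub_add_cancel]

/-- error polynomial -/
noncomputable def Gf (N : ℕ) : ArithmeticFunction ℝ :=
  tr N (zeta : ArithmeticFunction ℝ) * tr N vonMangoldt - tr N log

lemma Gf_zero (N n : ℕ) (hn : n ≤ N) : Gf N n = 0 := by
  rw [Gf, af_sub, tr_mul N _ _ n hn, zeta_mul_vonMangoldt, tr_apply, if_pos hn, sub_self]

lemma Gf_bd (N n : ℕ) : |Gf N n| ≤ Real.log n := by
  by_cases hn : n ≤ N
  · rw [Gf_zero N n hn, abs_zero]; exact Real.log_natCast_nonneg n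
  · rw [Gf, af_sub, tr_apply N log, if_neg hn, sub_zero]
    have := mul_mono (fun n => (tr_bd N zeta_nn n).1) (fun n => (tr_bd N (fun n => vonMangoldt_nonneg (n := n)) n).1)
      (fun n => (tr_bd N zeta_nn n).2) (fun n => (tr_bd N (fun n => vonMangoldt_nonneg (n := n)) n).2) n
    rw [zeta_mul_vonMangoldt] at this
    rw [abs_of_nonneg this.1]
    exact this.2

lemma SuppLT.mono {f : ArithmeticFunction ℝ} {R S : ℕ} (hf : SuppLT f R) (h : R ≤ S) : SuppLT f S :=
  fun n hn => hf n (h.trans hn)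

lemma Gf_supp (N : ℕ) : SuppLT (Gf N) ((N + 1) * (N + 1)) := by
  intro n hn
  rw [Gf, af_sub, (tr_supp N _).mul (tr_supp N _) n hn, tr_supp N _ n (by nlinarith), sub_zero]

lemma Dl_Gf {q : ℕ} (χ : DirichletCharacter ℂ q) (N : ℕ) :
    Dl χ (Gf N) = Dl χ (tr N (zeta : ArithmeticFunction ℝ)) * Dl χ (tr N vonMangoldt) - Dl χ (tr N log) := by
  rw [← Dl_mul χ (tr_supp N _) (tr_supp N _), Dl_eq χ (Gf_supp N), Dl_eq χ ((tr_supp N _).mul (tr_supp N _)),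
    Dl_eq χ ((tr_supp N log).mono (show N + 1 ≤ (N + 1) * (N + 1) by nlinarith)), ← sum_sub_distrib]
  refine sum_congr rfl fun n _ => ?_
  rw [Gf, af_sub]; push_cast; ring

lemma Dl_tr {q : ℕ} (χ : DirichletCharacter ℂ q) (N : ℕ) (f : ArithmeticFunction ℝ) :
    Dl χ (tr N f) = ∑ n ∈ range N, χ (n + 1 : ℕ) * ((f (n + 1) / (n + 1 : ℕ) : ℝ) : ℂ) := by
  rw [Dl_eq χ (tr_supp N f), sum_range_succ']
  simp only [Nat.cast_zero, div_zero, Complex.ofReal_zero, mul_zero, add_zero]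
  refine sum_congr rfl fun n hn => ?_
  rw [mem_range] at hn
  rw [tr_apply, if_pos (by omega)]

lemma PS_eq {q : ℕ} (χ : DirichletCharacter ℂ q) (N : ℕ) : PS χ N 1 = Dl χ (tr N (zeta : ArithmeticFunction ℝ)) := by
  rw [Dl_tr, PS]
  refine sum_congr rfl fun n _ => ?_
  rw [natCoe_apply, zeta_apply, if_neg (by omega), Complex.cpow_neg_one]
  push_cast; ring

lemma PSd_eq {q : ℕ} (χ : DirichletCharacter ℂ q) (N : ℕ) : PSd χ N 1 = Dl χ (tr N log) := by
  rw [Dl_tr, PSd]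
  refine sum_congr rfl fun n _ => ?_
  rw [log_apply, Complex.cpow_neg_one]
  push_cast; ring

lemma log_R_le (q : ℕ) (hq : 2 ≤ q) : 1 + Real.log (((q ^ 4 + 1) * (q ^ 4 + 1) : ℕ) : ℝ) ≤ 10 * (1 + Real.log q) := by
  have h1 : (((q ^ 4 + 1) * (q ^ 4 + 1) : ℕ) : ℝ) ≤ (q : ℝ) ^ 10 := by
    have : (q ^ 4 + 1) * (q ^ 4 + 1) ≤ q ^ 10 := by
      have h2 : q ^ 4 + 1 ≤ q ^ 5 := by
        have : 1 ≤ q ^ 4 := Nat.one_le_pow _ _ (by omega)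
        nlinarith [pow_succ q 4]
      calc _ ≤ q ^ 5 * q ^ 5 := Nat.mul_le_mul h2 h2
        _ = q ^ 10 := by ring
    exact_mod_cast this
  have h3 := Real.log_le_log (by positivity) h1
  rw [Real.log_pow] at h3
  have := Real.log_natCast_nonneg q
  push_cast at h3 ⊢
  linarith

lemma G_moment {q : ℕ} [NeZero q] (hq : q.Prime) :
    ∑ χ : DirichletCharacter ℂ q, ‖Dl χ (Gf (q ^ 4))‖ ^ 2 ≤ 30000 * (1 + Real.log q) ^ 4 := by
  set N := q ^ 4 with hN
  set R := (N + 1) * (N + 1) with hR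
  set l := 1 + Real.log R with hl
  have hlR := log_R_le q hq.two_le
  rw [← hN, ← hR, ← hl] at hlR
  have hl0 : 1 ≤ l := by rw [hl]; linarith [Real.log_natCast_nonneg R]
  have hq0 : (1:ℝ) ≤ q := by exact_mod_cast hq.one_le
  have hbd : ∀ n, n < R → |Gf N n| ≤ l := fun n hn => by
    refine (Gf_bd N n).trans ?_
    rcases Nat.eq_zero_or_pos n with rfl | h
    · simp; linarith
    · have := Real.log_le_log (by exact_mod_cast h) (show (n:ℝ) ≤ R by exact_mod_cast hn.le)
      linarith
  rw [Dl_sq hq (Gf_supp N), split_diag]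
  have h1 := (abs_le.1 (offdiag (q := q) hq.one_le hbd)).2
  have h2 : ∑ m ∈ range R, (if ¬ q ∣ m then (Gf N m) ^ 2 / (m : ℝ) ^ 2 else 0) ≤ l ^ 2 * (l / q) := by
    have hN0 : (0:ℝ) < N := by rw [hN]; have := hq.pos; positivity
    have hNq : (q:ℝ) ≤ N := by rw [hN]; exact_mod_cast Nat.le_self_pow (by norm_num) q
    calc _ ≤ ∑ m ∈ range R, l ^ 2 / N * (if m = 0 then 0 else (m:ℝ)⁻¹) := by
          refine sum_le_sum fun m hm => ?_
          by_cases hmN : m ≤ N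
          · rw [Gf_zero N m hmN]
            have : 0 ≤ l ^ 2 / N * (if m = 0 then 0 else (m:ℝ)⁻¹) := by split_ifs <;> positivity
            split_ifs at this ⊢ <;> simp at this ⊢ <;> positivity
          · push Not at hmN
            have hm0 : m ≠ 0 := by omega
            rw [if_neg hm0]
            have hmN' : (N:ℝ) ≤ m := by exact_mod_cast hmN.le
            have h3 : (Gf N m) ^ 2 / (m : ℝ) ^ 2 ≤ l ^ 2 / N * (m:ℝ)⁻¹ := by
              have : (Gf N m) ^ 2 ≤ l ^ 2 := by
                rw [← sq_abs]; exact pow_le_pow_left₀ (abs_nonneg _) (hbd m (mem_range.1 hm)) 2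
              calc (Gf N m) ^ 2 / (m : ℝ) ^ 2 ≤ l ^ 2 / (N * m) := by
                    rw [sq (m:ℝ)]; gcongr
                _ = _ := by field_simp
            split_ifs
            · positivity
            · exact h3
      _ = l ^ 2 / N * ∑ m ∈ range R, (if m = 0 then 0 else (m:ℝ)⁻¹) := by rw [mul_sum]
      _ ≤ l ^ 2 / q * l := by
          have : ∑ m ∈ range R, (if m = 0 then 0 else (m:ℝ)⁻¹) ≤ l := by
            refine le_trans ?_ (half_inv R)
            have hRp : R = (R - 1) + 1 := by have : 0 < R := by positivity
                                             omega
            rw [hRp, sum_range_succ', sum_range_succ]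
            simp only [if_true, add_zero, Nat.add_eq_zero_iff, one_ne_zero, and_false, if_false]
            have : (0:ℝ) ≤ (((R - 1 + 1 : ℕ)) : ℝ)⁻¹ := by positivity
            linarith
          gcongr
      _ = _ := by ring
  have h3 : 0 ≤ (q:ℝ) - 1 := by linarith
  calc ((q:ℝ) - 1) * _ ≤ ((q:ℝ) - 1) * (l ^ 2 * (l / q) + l ^ 2 * (2 * l ^ 2 / q)) := by
        apply mul_le_mul_of_nonneg_left _ h3
        linarith
    _ ≤ q * (l ^ 2 * (l / q) + l ^ 2 * (2 * l ^ 2 / q)) := by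
        apply mul_le_mul_of_nonneg_right (by linarith); positivity
    _ = l ^ 3 + 2 * l ^ 4 := by field_simp
    _ ≤ 3 * l ^ 4 := by nlinarith [pow_pos (show 0 < l by linarith) 3]
    _ ≤ 3 * (10 * (1 + Real.log q)) ^ 4 := by gcongr
    _ = _ := by ring

end TEC

namespace TEC
open Finset

lemma A_bd {q : ℕ} [NeZero q] (χ : DirichletCharacter ℂ q) :
    ‖Dl χ (tr (q ^ 4) vonMangoldt)‖ ≤ 16 * (1 + Real.log q) ^ 2 := by
  rw [Dl_tr]
  set N := q ^ 4 with hN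
  have hlN : Real.log N = 4 * Real.log q := by rw [hN]; push_cast; rw [Real.log_pow]; push_cast; ring
  have h0 := Real.log_natCast_nonneg q
  calc _ ≤ ∑ n ∈ range N, ‖χ (n + 1 : ℕ) * ((vonMangoldt (n + 1) / (n + 1 : ℕ) : ℝ) : ℂ)‖ := norm_sum_le _ _
    _ ≤ ∑ n ∈ range N, Real.log N * ((n + 1 : ℕ) : ℝ)⁻¹ := by
        refine sum_le_sum fun n hn => ?_
        rw [norm_mul, Complex.norm_real, Real.norm_eq_abs, abs_of_nonneg (div_nonneg vonMangoldt_nonneg (by positivity)), div_eq_mul_inv]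
        have h1 : vonMangoldt (n + 1) ≤ Real.log N := by
          refine vonMangoldt_le_log.trans ?_
          apply Real.log_le_log (by positivity)
          have := mem_range.1 hn
          exact_mod_cast this
        have h2 := χ.norm_le_one ((n + 1 : ℕ) : ZMod q)
        have h3 : 0 ≤ vonMangoldt (n + 1) * ((n + 1 : ℕ) : ℝ)⁻¹ := mul_nonneg vonMangoldt_nonneg (by positivity)
        calc _ ≤ 1 * (vonMangoldt (n + 1) * ((n + 1 : ℕ) : ℝ)⁻¹) := mul_le_mul_of_nonneg_right h2 h3
          _ ≤ _ := by rw [one_mul]; gcongr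
    _ = Real.log N * ∑ n ∈ range N, ((n + 1 : ℕ) : ℝ)⁻¹ := by rw [mul_sum]
    _ ≤ Real.log N * (1 + Real.log N) := by
        have := half_inv N
        have := Real.log_natCast_nonneg N
        gcongr
    _ ≤ _ := by rw [hlN]; nlinarith

lemma card_char {q : ℕ} [NeZero q] : ((univ : Finset (DirichletCharacter ℂ q)).card : ℝ) ≤ q := by
  have h := DirichletCharacter.card_eq_totient_of_hasEnoughRootsOfUnity ℂ q
  rw [Nat.card_eq_fintype_card] at h
  rw [card_univ, h]
  exact_mod_cast Nat.totient_le q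

lemma G_one {q : ℕ} [NeZero q] (hq : q.Prime) :
    ∑ χ : DirichletCharacter ℂ q, ‖Dl χ (Gf (q ^ 4))‖ ≤ 200 * (q : ℝ) ^ (1 / 2 : ℝ) * (1 + Real.log q) ^ 2 := by
  have h0 := Real.log_natCast_nonneg q
  refine abs_le_of_sq_le_sq' ?_ (by positivity) |>.2
  calc _ ≤ ((univ : Finset (DirichletCharacter ℂ q)).card : ℝ) * ∑ χ : DirichletCharacter ℂ q, ‖Dl χ (Gf (q ^ 4))‖ ^ 2 :=
        sq_sum_le_card_mul_sum_sq
    _ ≤ q * (30000 * (1 + Real.log q) ^ 4) := 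
        mul_le_mul card_char (G_moment hq) (by positivity) (by positivity)
    _ ≤ q * (40000 * (1 + Real.log q) ^ 4) := by gcongr; norm_num
    _ = (200 * (q : ℝ) ^ (1 / 2 : ℝ) * (1 + Real.log q) ^ 2) ^ 2 := by
        have : ((q : ℝ) ^ (1 / 2 : ℝ)) ^ 2 = q := by
          rw [← Real.rpow_natCast, ← Real.rpow_mul (by positivity)]; norm_num
        rw [mul_pow, mul_pow, this]; ring

lemma cmp (k : ℕ) (hk : 1 ≤ k) : ∃ C : ℝ, 0 < C ∧ ∀ (q : ℕ) [NeZero q], q.Prime →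
    |(∑ χ : DirichletCharacter ℂ q, if χ ≠ 1 then ‖logDeriv (DirichletCharacter.LFunction χ) 1‖ ^ (2 * k) else 0) -
      ∑ χ : DirichletCharacter ℂ q, if χ ≠ 1 then ‖Dl χ (tr (q ^ 4) vonMangoldt)‖ ^ (2 * k) else 0| ≤ C * (q : ℝ) ^ (9 / 10 : ℝ) := by
  have hk' : (1:ℝ) ≤ k := by exact_mod_cast hk
  set ε : ℝ := 1 / (10 * k) with hε
  have hε0 : 0 < ε := by positivity
  have hεk : ε * (2 * k) = 1 / 5 := by rw [hε]; field_simp; norm_num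
  obtain ⟨K, hK, hL⟩ := LFunction_bounds
  obtain ⟨C1, hC1, hinv⟩ := inv_L (ε / 2) (by linarith)
  obtain ⟨C4, hC4, hl4⟩ := rpow_add_log (ε / 2) (by linarith) 2
  obtain ⟨C3, hC3, hl3⟩ := rpow_add_log (1 / 10) (by norm_num) 2
  set U0 := K * C4 * C1 + 16 * C4 with hU0
  have hU0p : 0 < U0 := by positivity
  refine ⟨2 * k * U0 ^ (2 * k - 1) * C1 * ((200 + 17 * K) * C3), by positivity, ?_⟩
  intro q _ hq
  have hq0 : (1:ℝ) ≤ q := by exact_mod_cast hq.one_le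
  have hqp : (0:ℝ) < q := by linarith
  set l := 1 + Real.log q with hl
  have hl1 : 1 ≤ l := by rw [hl]; linarith [Real.log_natCast_nonneg q]
  set U := U0 * (q:ℝ) ^ ε with hU
  have hUp : 0 < U := by positivity
  have hqee : (q:ℝ) ^ (ε / 2) * (q:ℝ) ^ (ε / 2) = (q:ℝ) ^ ε := by
    rw [← Real.rpow_add hqp]; ring_nf
  have hqe1 : (1:ℝ) ≤ (q:ℝ) ^ (ε / 2) := Real.one_le_rpow hq0 (by linarith)
  have hqe2 : (q:ℝ) ^ (ε / 2) ≤ (q:ℝ) ^ ε := Real.rpow_le_rpow_of_exponent_le hq0 (by linarith)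
  have hl4q := hl4 q hq0
  rw [← hl] at hl4q
  have hAU : ∀ χ : DirichletCharacter ℂ q, ‖Dl χ (tr (q ^ 4) vonMangoldt)‖ ≤ U := by
    intro χ
    refine (A_bd χ).trans ?_
    rw [← hl]
    calc 16 * l ^ 2 ≤ 16 * (C4 * (q:ℝ) ^ ε) := by gcongr; exact hl4q.trans (by gcongr)
      _ ≤ U := by
        rw [hU, hU0]
        have : 0 ≤ K * C4 * C1 * (q:ℝ) ^ ε := by positivity
        nlinarith
  have hYU : ∀ χ : DirichletCharacter ℂ q, χ ≠ 1 → ‖logDeriv (DirichletCharacter.LFunction χ) 1‖ ≤ U := by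
    intro χ hχ
    have h1 := (hL q χ hχ 1 le_rfl (by norm_num)).2.2.2
    simp only [Complex.ofReal_one] at h1
    rw [logDeriv_apply, norm_div, div_eq_mul_inv]
    calc _ ≤ (K * l ^ 2) * (C1 * (q:ℝ) ^ (ε / 2)) := by gcongr; exact hinv q χ hq hχ
      _ ≤ (K * (C4 * (q:ℝ) ^ (ε / 2))) * (C1 * (q:ℝ) ^ (ε / 2)) := by gcongr
      _ = K * C4 * C1 * (q:ℝ) ^ ε := by rw [← hqee]; ring
      _ ≤ U := by
        rw [hU, hU0]
        have : 0 ≤ 16 * C4 * (q:ℝ) ^ ε := by positivity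
        nlinarith
  have hd : ∀ χ : DirichletCharacter ℂ q, χ ≠ 1 →
      |‖logDeriv (DirichletCharacter.LFunction χ) 1‖ - ‖Dl χ (tr (q ^ 4) vonMangoldt)‖| ≤
      C1 * (q:ℝ) ^ ε * (‖Dl χ (Gf (q ^ 4))‖ + 17 * K * l ^ 2 / q) := by
    intro χ hχ
    obtain ⟨h1, h2, -, -⟩ := hL q χ hχ 1 le_rfl (by norm_num)
    simp only [Complex.ofReal_one] at h1 h2
    rw [PS_eq] at h1
    rw [PSd_eq] at h2
    have hA := A_bd χ
    rw [← hl] at hA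
    have hG := Dl_Gf χ (q ^ 4)
    set A := Dl χ (tr (q ^ 4) vonMangoldt)
    set P := Dl χ (tr (q ^ 4) (zeta : ArithmeticFunction ℝ))
    set P' := Dl χ (tr (q ^ 4) log)
    set G := Dl χ (Gf (q ^ 4))
    have hL0 : DirichletCharacter.LFunction χ 1 ≠ 0 := DirichletCharacter.LFunction_apply_one_ne_zero hχ
    have hi := hinv q χ hq hχ
    rw [logDeriv_apply]
    set L0 := DirichletCharacter.LFunction χ 1
    set L1 := deriv (DirichletCharacter.LFunction χ) 1
    have h3 := abs_norm_sub_norm_le (L1 / L0) (-A)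
    rw [norm_neg] at h3
    refine h3.trans ?_
    have e : L1 / L0 - -A = ((L1 + P') + (L0 - P) * A + G) * L0⁻¹ := by
      rw [hG]; field_simp; ring
    rw [e, norm_mul, norm_inv, mul_comm]
    have h4 : ‖(L1 + P') + (L0 - P) * A + G‖ ≤ ‖G‖ + 17 * K * l ^ 2 / q := by
      calc _ ≤ ‖L1 + P'‖ + ‖(L0 - P) * A‖ + ‖G‖ := norm_add₃_le
        _ ≤ K / q + K / q * (16 * l ^ 2) + ‖G‖ := by rw [norm_mul]; gcongr
        _ ≤ _ := by
          have : K / q ≤ K * l ^ 2 / q := by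
            gcongr; exact le_mul_of_one_le_right hK.le (one_le_pow₀ hl1)
          have e : K / q * (16 * l ^ 2) + K * l ^ 2 / q = 17 * K * l ^ 2 / q := by ring
          linarith
    exact mul_le_mul (hi.trans (by gcongr)) h4 (norm_nonneg _) (by positivity)
  have hterm : ∀ χ : DirichletCharacter ℂ q, |(if χ ≠ 1 then ‖logDeriv (DirichletCharacter.LFunction χ) 1‖ ^ (2 * k) else 0) -
      (if χ ≠ 1 then ‖Dl χ (tr (q ^ 4) vonMangoldt)‖ ^ (2 * k) else 0)| ≤
      2 * k * U ^ (2 * k - 1) * (C1 * (q:ℝ) ^ ε) * (‖Dl χ (Gf (q ^ 4))‖ + 17 * K * l ^ 2 / q) := by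
    intro χ
    by_cases hχ : χ ≠ 1
    · rw [if_pos hχ, if_pos hχ]
      refine (abs_pow_sub_pow_le _ _ _).trans ?_
      rw [abs_of_nonneg (norm_nonneg _), abs_of_nonneg (norm_nonneg _)]
      have hm : max ‖logDeriv (DirichletCharacter.LFunction χ) 1‖ ‖Dl χ (tr (q ^ 4) vonMangoldt)‖ ≤ U :=
        max_le (hYU χ hχ) (hAU χ)
      calc _ ≤ (C1 * (q:ℝ) ^ ε * (‖Dl χ (Gf (q ^ 4))‖ + 17 * K * l ^ 2 / q)) * ((2 * k : ℕ) : ℝ) * U ^ (2 * k - 1) := by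
            have := hd χ hχ
            gcongr
        _ = _ := by push_cast; ring
    · rw [if_neg hχ, if_neg hχ, sub_self, abs_zero]; positivity
  rw [← sum_sub_distrib]
  refine (abs_sum_le_sum_abs _ _).trans ((sum_le_sum fun χ _ => hterm χ).trans ?_)
  rw [← mul_sum, sum_add_distrib, sum_const, nsmul_eq_mul]
  have hs : (∑ χ : DirichletCharacter ℂ q, ‖Dl χ (Gf (q ^ 4))‖) + ((univ : Finset (DirichletCharacter ℂ q)).card : ℝ) * (17 * K * l ^ 2 / q)
      ≤ (200 + 17 * K) * C3 * ((q:ℝ) ^ (1 / 2 : ℝ) * (q:ℝ) ^ (1 / 10 : ℝ)) := by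
    have a1 := G_one hq
    rw [← hl] at a1
    have a2 : ((univ : Finset (DirichletCharacter ℂ q)).card : ℝ) * (17 * K * l ^ 2 / q) ≤ 17 * K * l ^ 2 := by
      calc _ ≤ (q:ℝ) * (17 * K * l ^ 2 / q) := 
            mul_le_mul_of_nonneg_right card_char (by positivity)
        _ = _ := by field_simp
    have a3 : 17 * K * l ^ 2 ≤ 17 * K * (q:ℝ) ^ (1 / 2 : ℝ) * l ^ 2 := by
      have : (1:ℝ) ≤ (q:ℝ) ^ (1 / 2 : ℝ) := Real.one_le_rpow hq0 (by norm_num)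
      have h5 : 0 ≤ 17 * K * l ^ 2 := by positivity
      nlinarith
    have a4 := hl3 q hq0
    rw [← hl] at a4
    calc _ ≤ (200 + 17 * K) * (q:ℝ) ^ (1 / 2 : ℝ) * l ^ 2 := by linarith
      _ ≤ (200 + 17 * K) * (q:ℝ) ^ (1 / 2 : ℝ) * (C3 * (q:ℝ) ^ (1 / 10 : ℝ)) := by gcongr
      _ = _ := by ring
  have hp : U ^ (2 * k - 1) * (q:ℝ) ^ ε = U0 ^ (2 * k - 1) * (q:ℝ) ^ (1 / 5 : ℝ) := by
    rw [hU, mul_pow, mul_assoc, ← pow_succ, Nat.sub_add_cancel (by omega), ← Real.rpow_natCast ((q:ℝ) ^ ε), ← Real.rpow_mul hqp.le]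
    push_cast
    rw [hεk]
  have hq8 : (q:ℝ) ^ (1 / 5 : ℝ) * ((q:ℝ) ^ (1 / 2 : ℝ) * (q:ℝ) ^ (1 / 10 : ℝ)) ≤ (q:ℝ) ^ (9 / 10 : ℝ) := by
    rw [← Real.rpow_add hqp, ← Real.rpow_add hqp]
    exact Real.rpow_le_rpow_of_exponent_le hq0 (by norm_num)
  calc _ ≤ 2 * k * U ^ (2 * k - 1) * (C1 * (q:ℝ) ^ ε) * ((200 + 17 * K) * C3 * ((q:ℝ) ^ (1 / 2 : ℝ) * (q:ℝ) ^ (1 / 10 : ℝ))) := by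
        gcongr
    _ = 2 * k * C1 * ((200 + 17 * K) * C3) * (U ^ (2 * k - 1) * (q:ℝ) ^ ε) * ((q:ℝ) ^ (1 / 2 : ℝ) * (q:ℝ) ^ (1 / 10 : ℝ)) := by ring
    _ = 2 * k * U0 ^ (2 * k - 1) * C1 * ((200 + 17 * K) * C3) * ((q:ℝ) ^ (1 / 5 : ℝ) * ((q:ℝ) ^ (1 / 2 : ℝ) * (q:ℝ) ^ (1 / 10 : ℝ))) := by
        rw [hp]; ring
    _ ≤ _ := by gcongr

end TEC

namespace TEC
open Finset

lemma pow_supp {f : ArithmeticFunction ℝ} {R : ℕ} (hf : SuppLT f R) (k : ℕ) : SuppLT (f ^ (k + 1)) (R ^ (k + 1)) := by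
  induction k with
  | zero => simpa using hf
  | succ k ih => rw [pow_succ f, pow_succ R]; exact ih.mul hf

lemma Dl_pow {q : ℕ} (χ : DirichletCharacter ℂ q) {f : ArithmeticFunction ℝ} {R : ℕ} (hf : SuppLT f R) (k : ℕ) :
    Dl χ (f ^ (k + 1)) = Dl χ f ^ (k + 1) := by
  induction k with
  | zero => simp
  | succ k ih => rw [pow_succ f, Dl_mul χ (pow_supp hf k) hf, ih, ← pow_succ]

lemma one_nn (n : ℕ) : 0 ≤ (1 : ArithmeticFunction ℝ) n ∧ (1 : ArithmeticFunction ℝ) n ≤ 1 := by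
  rw [one_apply]; split_ifs <;> norm_num

lemma lam_bd (k n : ℕ) : 0 ≤ (vonMangoldt ^ k) n ∧ (vonMangoldt ^ k) n ≤ Real.log n ^ k := by
  induction k generalizing n with
  | zero => simpa using one_nn n
  | succ k ih =>
    rw [pow_succ]
    refine ⟨(mul_mono (fun n => (ih n).1) (fun n => vonMangoldt_nonneg) (fun n => le_rfl) (fun n => le_rfl) n).1, ?_⟩
    rcases Nat.eq_zero_or_pos n with rfl | hn
    · simp
    rw [mul_apply, pow_succ]
    calc _ ≤ ∑ p ∈ n.divisorsAntidiagonal, Real.log n ^ k * vonMangoldt p.2 := by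
          refine sum_le_sum fun p hp => ?_
          have h1 := (Nat.mem_divisorsAntidiagonal.1 hp).1
          have hp1 : 0 < p.1 := Nat.pos_of_ne_zero (by rintro h; rw [h] at h1; simp at h1; omega)
          have h3 : p.1 ≤ n := Nat.le_of_dvd (by omega) ⟨p.2, h1.symm⟩
          refine mul_le_mul_of_nonneg_right ((ih _).2.trans ?_) vonMangoldt_nonneg
          have := Real.log_natCast_nonneg p.1
          gcongr
      _ = _ := by
          rw [← mul_sum, Nat.sum_divisorsAntidiagonal' (f := fun _ j => vonMangoldt j), vonMangoldt_sum]

lemma tr_pow_bd (N k n : ℕ) : 0 ≤ (tr N vonMangoldt ^ k) n ∧ (tr N vonMangoldt ^ k) n ≤ (vonMangoldt ^ k) n := by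
  induction k generalizing n with
  | zero => simpa using (one_nn n).1
  | succ k ih =>
    rw [pow_succ, pow_succ]
    exact mul_mono (fun n => (ih n).1) (fun n => (tr_bd N (fun n => vonMangoldt_nonneg (n := n)) n).1)
      (fun n => (ih n).2) (fun n => (tr_bd N (fun n => vonMangoldt_nonneg (n := n)) n).2) n

lemma tr_pow_eq (N k n : ℕ) (hn : n ≤ N) : (tr N vonMangoldt ^ k) n = (vonMangoldt ^ k) n := by
  induction k generalizing n with
  | zero => simp
  | succ k ih =>
    rw [pow_succ, pow_succ, mul_apply, mul_apply]
    refine sum_congr rfl fun p hp => ?_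
    have h1 := (Nat.mem_divisorsAntidiagonal.1 hp).1
    have h2 := (Nat.mem_divisorsAntidiagonal.1 hp).2
    have h3 : p.1 ≤ n := Nat.le_of_dvd (by omega) ⟨p.2, h1.symm⟩
    have h4 : p.2 ≤ n := Nat.le_of_dvd (by omega) ⟨p.1, by rw [mul_comm]; exact h1.symm⟩
    rw [ih _ (by omega), tr_apply, if_pos (by omega)]

lemma mul_pow_add (a l : ℝ) (k : ℕ) : 2 * (a * l) ^ (k * 2) * (a * l) ^ 2 = 2 * a ^ (2 * k + 2) * l ^ (2 * k + 2) := by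
  rw [mul_assoc, ← pow_add, mul_pow, mul_comm k 2, mul_assoc]

lemma arch (k : ℕ) (hk : 1 ≤ k) : ∃ C : ℝ, 0 < C ∧ ∀ (q : ℕ) [NeZero q], q.Prime →
    |(∑ χ : DirichletCharacter ℂ q, if χ ≠ 1 then ‖Dl χ (tr (q ^ 4) vonMangoldt)‖ ^ (2 * k) else 0) -
      ((q:ℝ) - 1) * ∑' m : ℕ, (if ¬ q ∣ m then (tr (q ^ 4) vonMangoldt ^ k) m ^ 2 / (m:ℝ) ^ 2 else 0)| ≤ C * (q : ℝ) ^ (9 / 10 : ℝ) := by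
  obtain ⟨k, rfl⟩ : ∃ j, k = j + 1 := ⟨k - 1, by omega⟩
  set k1 := k + 1 with hk1
  obtain ⟨C1, hC1, h1⟩ := rpow_add_log (9 / 10) (by norm_num) (4 * k1)
  obtain ⟨C2, hC2, h2⟩ := rpow_add_log (9 / 10) (by norm_num) (2 * k1 + 2)
  refine ⟨16 ^ (2 * k1) * C1 + 2 * (5 * k1) ^ (2 * k1 + 2) * C2, by positivity, fun q _ hq => ?_⟩
  have hq0 : (1:ℝ) ≤ q := by exact_mod_cast hq.one_lt.le
  have hl0 := Real.log_natCast_nonneg q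
  set l := 1 + Real.log q with hl
  set c := tr (q ^ 4) vonMangoldt ^ k1 with hc
  set R := (q ^ 4 + 1) ^ k1 with hR
  have hs : SuppLT c R := pow_supp (tr_supp _ _) k
  have e1 : ∀ χ : DirichletCharacter ℂ q, ‖Dl χ (tr (q ^ 4) vonMangoldt)‖ ^ (2 * k1) = ‖Dl χ c‖ ^ 2 := by
    intro χ
    rw [hc, hk1, Dl_pow χ (tr_supp _ _), norm_pow, ← pow_mul, mul_comm]
  have e2 : (∑ χ : DirichletCharacter ℂ q, if χ ≠ 1 then ‖Dl χ (tr (q ^ 4) vonMangoldt)‖ ^ (2 * k1) else 0)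
      = (∑ χ : DirichletCharacter ℂ q, ‖Dl χ c‖ ^ 2) - ‖Dl (1 : DirichletCharacter ℂ q) c‖ ^ 2 := by
    rw [eq_sub_iff_add_eq, ← Finset.add_sum_erase univ (fun χ : DirichletCharacter ℂ q => ‖Dl χ c‖ ^ 2) (mem_univ 1),
      ← Finset.add_sum_erase univ _ (mem_univ (1 : DirichletCharacter ℂ q))]
    simp only [ne_eq, not_true_eq_false, if_false, zero_add]
    rw [add_comm]
    congr 1
    refine sum_congr rfl fun χ hχ => ?_
    rw [if_pos (ne_of_mem_erase hχ), e1]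
  have e3 : ∑' m : ℕ, (if ¬ q ∣ m then c m ^ 2 / (m:ℝ) ^ 2 else 0) = ∑ m ∈ range R, if ¬ q ∣ m then c m ^ 2 / (m:ℝ) ^ 2 else 0 := by
    refine tsum_eq_sum fun m hm => ?_
    rw [hs m (by simpa using hm)]; simp
  have hlR : 1 + Real.log R ≤ 5 * k1 * l := by
    have : Real.log ((q:ℝ) ^ 4 + 1) ≤ 4 * Real.log q + 1 := by
      calc _ ≤ Real.log ((q:ℝ) ^ 4 * 2) := by
            apply Real.log_le_log (by positivity)
            have : (1:ℝ) ≤ (q:ℝ) ^ 4 := one_le_pow₀ hq0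
            linarith
        _ = 4 * Real.log q + Real.log 2 := by
            rw [Real.log_mul (by positivity) (by norm_num), Real.log_pow]; norm_num
        _ ≤ _ := by have := Real.log_two_lt_d9; linarith
    have hk0 : (1:ℝ) ≤ k1 := by exact_mod_cast hk
    rw [hR]; push_cast
    rw [Real.log_pow]
    have h3 : (k1:ℝ) * Real.log ((q:ℝ) ^ 4 + 1) ≤ k1 * (4 * Real.log q + 1) := by gcongr
    rw [hl]
    nlinarith
  have hK : ∀ n, n < R → |c n| ≤ (5 * k1 * l) ^ k1 := by
    intro n hn
    rw [abs_of_nonneg (tr_pow_bd _ _ _).1]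
    refine ((tr_pow_bd _ _ _).2.trans (lam_bd _ _).2).trans ?_
    refine pow_le_pow_left₀ (Real.log_natCast_nonneg n) ?_ _
    rcases Nat.eq_zero_or_pos n with rfl | hn0
    · simp; positivity
    have : Real.log n ≤ Real.log R := Real.log_le_log (by exact_mod_cast hn0) (by exact_mod_cast hn.le)
    linarith
  have ho := offdiag hq.one_lt.le hK
  rw [e2, e3, Dl_sq hq hs, split_diag]
  set D := ∑ m ∈ range R, if ¬ q ∣ m then c m ^ 2 / (m:ℝ) ^ 2 else 0
  have hp : ‖Dl (1 : DirichletCharacter ℂ q) c‖ ^ 2 ≤ 16 ^ (2 * k1) * C1 * (q:ℝ) ^ (9 / 10 : ℝ) := by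
    rw [← e1]
    calc _ ≤ (16 * l ^ 2) ^ (2 * k1) := by gcongr; exact A_bd _
      _ = 16 ^ (2 * k1) * l ^ (4 * k1) := by rw [mul_pow, ← pow_mul]; congr 2; ring
      _ ≤ 16 ^ (2 * k1) * (C1 * (q:ℝ) ^ (9 / 10 : ℝ)) := by gcongr; exact h1 q hq0
      _ = _ := by ring
  generalize (∑ m ∈ range R, ∑ n ∈ range R, if (m ≡ n [MOD q] ∧ ¬ q ∣ m) ∧ m ≠ n then c m / m * (c n / n) else 0) = O at ho ⊢
  have hO : |((q:ℝ) - 1) * O| ≤ 2 * (5 * k1) ^ (2 * k1 + 2) * C2 * (q:ℝ) ^ (9 / 10 : ℝ) := by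
    rw [abs_mul, abs_of_nonneg (by linarith)]
    calc _ ≤ (q:ℝ) * (((5 * k1 * l) ^ k1) ^ 2 * (2 * (1 + Real.log R) ^ 2 / q)) := by
          refine mul_le_mul (by linarith) ho (abs_nonneg _) (by positivity)
      _ ≤ (q:ℝ) * (((5 * k1 * l) ^ k1) ^ 2 * (2 * (5 * k1 * l) ^ 2 / q)) := by
          have := Real.log_natCast_nonneg R
          gcongr
      _ = 2 * (5 * k1) ^ (2 * k1 + 2) * l ^ (2 * k1 + 2) := by
          have hq1 : (q:ℝ) ≠ 0 := by positivity
          generalize (5 * (k1:ℝ)) = a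
          rw [← pow_mul, ← mul_pow_add a l]
          field_simp
      _ ≤ 2 * (5 * k1) ^ (2 * k1 + 2) * (C2 * (q:ℝ) ^ (9 / 10 : ℝ)) := by gcongr; exact h2 q hq0
      _ = _ := by ring
  have e4 : ((q:ℝ) - 1) * (D + O) - ‖Dl (1 : DirichletCharacter ℂ q) c‖ ^ 2 - ((q:ℝ) - 1) * D
      = ((q:ℝ) - 1) * O - ‖Dl (1 : DirichletCharacter ℂ q) c‖ ^ 2 := by ring
  rw [e4]
  have := sq_nonneg ‖Dl (1 : DirichletCharacter ℂ q) c‖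
  rw [abs_le] at hO ⊢
  constructor <;> nlinarith [hO.1, hO.2]

end TEC

namespace TEC
open Finset

lemma coprimePart_of_not_dvd {q N : ℕ} (hq : q.Prime) (h : ¬ q ∣ N) : coprimePart q N = q := by
  rw [coprimePart]
  exact Nat.findGreatest_eq ⟨dvd_rfl, (Nat.Prime.coprime_iff_not_dvd hq).2 h⟩

lemma coprimePart_of_dvd {q N : ℕ} (hq : q.Prime) (h : q ∣ N) : coprimePart q N = 1 := by
  have := Nat.findGreatest_spec (P := fun d => d ∣ q ∧ Nat.Coprime d N) (n := q) (m := 1) hq.one_lt.le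
    ⟨one_dvd _, Nat.coprime_one_left N⟩
  rw [← coprimePart] at this
  rcases (Nat.dvd_prime hq).1 this.1 with h1 | h1
  · exact h1
  · exact absurd h ((Nat.Prime.coprime_iff_not_dvd hq).1 (h1 ▸ this.2))

lemma regroup_enn (k : ℕ) (G : ℕ → ENNReal) :
    ∑' p : Fin k → ℕ, ENNReal.ofReal (∏ i, vonMangoldt (p i)) * G (∏ i, p i) =
      ∑' m : ℕ, ENNReal.ofReal ((vonMangoldt ^ k) m) * G m := by
  induction k generalizing G with
  | zero =>
    rw [tsum_eq_single (default : Fin 0 → ℕ) (fun b hb => absurd (Subsingleton.elim b _) hb),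
      tsum_eq_single 1 (fun b hb => by simp [one_apply, hb])]
    simp
  | succ k ih =>
    rw [← (Fin.consEquiv (fun _ : Fin (k + 1) => ℕ)).tsum_eq, ENNReal.tsum_prod']
    simp only [Fin.consEquiv_apply, Fin.prod_univ_succ, Fin.cons_zero, Fin.cons_succ]
    have e1 : ∀ a : ℕ, ∑' p : Fin k → ℕ, ENNReal.ofReal (vonMangoldt a * ∏ i, vonMangoldt (p i)) * G (a * ∏ i, p i)
        = ∑' m : ℕ, ENNReal.ofReal (vonMangoldt a * (vonMangoldt ^ k) m) * G (a * m) := by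
      intro a
      have := ih (fun m => ENNReal.ofReal (vonMangoldt a) * G (a * m))
      convert this using 2 with p m
      · funext z; rw [ENNReal.ofReal_mul vonMangoldt_nonneg]; ring
      · funext z; rw [ENNReal.ofReal_mul vonMangoldt_nonneg]; ring
    rw [tsum_congr e1, ← ENNReal.tsum_prod (f := fun a m => ENNReal.ofReal (vonMangoldt a * (vonMangoldt ^ k) m) * G (a * m))]
    have e2 : ∀ x : ℕ × ℕ, ENNReal.ofReal (vonMangoldt x.1 * (vonMangoldt ^ k) x.2) * G (x.1 * x.2) =
        ∑' n : ℕ, if x.1 * x.2 = n then ENNReal.ofReal (vonMangoldt x.1 * (vonMangoldt ^ k) x.2) * G n else 0 := by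
      intro x
      rw [tsum_eq_single (x.1 * x.2) (fun b hb => if_neg (Ne.symm hb)), if_pos rfl]
    rw [tsum_congr e2, ENNReal.tsum_comm]
    refine tsum_congr fun n => ?_
    rcases Nat.eq_zero_or_pos n with rfl | hn
    · rw [ArithmeticFunction.map_zero, ENNReal.ofReal_zero, zero_mul]
      refine ENNReal.tsum_eq_zero.2 fun x => ?_
      split_ifs with h
      · rcases Nat.mul_eq_zero.1 h with h | h <;> simp [h]
      · rfl
    · rw [tsum_eq_sum (s := n.divisorsAntidiagonal)]
      · rw [pow_succ', mul_apply, ENNReal.ofReal_sum_of_nonneg (fun p _ => mul_nonneg vonMangoldt_nonneg (lam_bd k _).1), sum_mul]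
        refine sum_congr rfl fun p hp => ?_
        rw [if_pos (Nat.mem_divisorsAntidiagonal.1 hp).1]
      · intro x hx
        rw [if_neg]
        intro h
        exact hx (Nat.mem_divisorsAntidiagonal.2 ⟨h, by omega⟩)

lemma regroup (k : ℕ) (F : ℕ → ℕ → ℝ) (hF : ∀ m n, 0 ≤ F m n) :
    ∑' p : (Fin k → ℕ) × (Fin k → ℕ), (∏ i, vonMangoldt (p.1 i)) * (∏ i, vonMangoldt (p.2 i)) * F (∏ i, p.1 i) (∏ i, p.2 i) =
      ∑' x : ℕ × ℕ, (vonMangoldt ^ k) x.1 * (vonMangoldt ^ k) x.2 * F x.1 x.2 := by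
  have n1 : ∀ p : Fin k → ℕ, 0 ≤ ∏ i, vonMangoldt (p i) := fun p => prod_nonneg fun _ _ => vonMangoldt_nonneg
  have h1 := ENNReal.tsum_toReal_eq (f := fun p : (Fin k → ℕ) × (Fin k → ℕ) => ENNReal.ofReal ((∏ i, vonMangoldt (p.1 i)) * (∏ i, vonMangoldt (p.2 i)) * F (∏ i, p.1 i) (∏ i, p.2 i))) (fun _ => ENNReal.ofReal_ne_top)
  have h2 := ENNReal.tsum_toReal_eq (f := fun x : ℕ × ℕ => ENNReal.ofReal ((vonMangoldt ^ k) x.1 * (vonMangoldt ^ k) x.2 * F x.1 x.2)) (fun _ => ENNReal.ofReal_ne_top)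
  have e1 : ∀ p : (Fin k → ℕ) × (Fin k → ℕ), 0 ≤ (∏ i, vonMangoldt (p.1 i)) * (∏ i, vonMangoldt (p.2 i)) * F (∏ i, p.1 i) (∏ i, p.2 i) :=
    fun p => mul_nonneg (mul_nonneg (n1 _) (n1 _)) (hF _ _)
  have e2 : ∀ x : ℕ × ℕ, 0 ≤ (vonMangoldt ^ k) x.1 * (vonMangoldt ^ k) x.2 * F x.1 x.2 :=
    fun x => mul_nonneg (mul_nonneg (lam_bd _ _).1 (lam_bd _ _).1) (hF _ _)
  simp only [ENNReal.toReal_ofReal (e1 _)] at h1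
  simp only [ENNReal.toReal_ofReal (e2 _)] at h2
  rw [← h1, ← h2]
  congr 1
  rw [ENNReal.tsum_prod', ENNReal.tsum_prod']
  have s1 : ∀ a : Fin k → ℕ, ∑' b : Fin k → ℕ, ENNReal.ofReal ((∏ i, vonMangoldt (a i)) * (∏ i, vonMangoldt (b i)) * F (∏ i, a i) (∏ i, b i))
      = ENNReal.ofReal (∏ i, vonMangoldt (a i)) * ∑' n : ℕ, ENNReal.ofReal ((vonMangoldt ^ k) n) * ENNReal.ofReal (F (∏ i, a i) n) := by
    intro a
    rw [← regroup_enn, ← ENNReal.tsum_mul_left]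
    refine tsum_congr fun b => ?_
    rw [ENNReal.ofReal_mul (mul_nonneg (n1 _) (n1 _)), ENNReal.ofReal_mul (n1 _), mul_assoc]
  rw [tsum_congr s1, regroup_enn k (fun m => ∑' n : ℕ, ENNReal.ofReal ((vonMangoldt ^ k) n) * ENNReal.ofReal (F m n))]
  refine tsum_congr fun m => ?_
  rw [← ENNReal.tsum_mul_left]
  refine tsum_congr fun n => ?_
  rw [ENNReal.ofReal_mul (mul_nonneg (lam_bd _ _).1 (lam_bd _ _).1), ENNReal.ofReal_mul (lam_bd _ _).1, mul_assoc]

end TEC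

namespace TEC
open Finset

lemma lam_rpow (k : ℕ) : ∃ C : ℝ, 0 < C ∧ ∀ n : ℕ, (vonMangoldt ^ k) n ≤ C * (n:ℝ) ^ (1 / 4 : ℝ) := by
  obtain ⟨C, hC, h⟩ := rpow_add_log (1 / 4) (by norm_num) k
  refine ⟨C, hC, fun n => ?_⟩
  rcases Nat.eq_zero_or_pos n with rfl | hn
  · simp
  refine (lam_bd k n).2.trans (le_trans ?_ (h n (by exact_mod_cast hn)))
  have := Real.log_natCast_nonneg n
  gcongr
  linarith

/-- weight -/
noncomputable def w (n : ℕ) : ℝ := (n:ℝ) ^ (-(5 / 4) : ℝ)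

lemma w_nn (n : ℕ) : 0 ≤ w n := by unfold w; positivity

lemma w_anti (m n : ℕ) (h : 1 ≤ m) (h2 : m ≤ n) : w n ≤ w m :=
  Real.rpow_le_rpow_of_nonpos (by exact_mod_cast h) (by exact_mod_cast h2) (by norm_num)

lemma w_summable : Summable w := Real.summable_nat_rpow.2 (by norm_num)

lemma w_pair_summable : Summable (fun x : ℕ × ℕ => w x.1 * w x.2) :=
  w_summable.mul_of_nonneg w_summable w_nn w_nn

lemma w_pair_tsum : ∑' x : ℕ × ℕ, w x.1 * w x.2 = (∑' n, w n) ^ 2 := by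
  rw [sq, w_summable.tsum_mul_tsum w_summable w_pair_summable]

/-- off-diagonal weights -/
noncomputable def od (q : ℕ) (x : ℕ × ℕ) : ℝ :=
  if x.1 ≡ x.2 [MOD q] ∧ x.1 ≠ x.2 ∧ x.1 ≠ 0 ∧ x.2 ≠ 0 then w x.1 * w x.2 else 0

lemma od_nn (q : ℕ) (x : ℕ × ℕ) : 0 ≤ od q x := by
  unfold od; split_ifs
  · exact mul_nonneg (w_nn _) (w_nn _)
  · rfl

lemma od_summable (q : ℕ) : Summable (od q) := by
  refine Summable.of_nonneg_of_le (od_nn q) (fun x => ?_) w_pair_summable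
  unfold od; split_ifs
  · rfl
  · exact mul_nonneg (w_nn _) (w_nn _)

lemma od_tsum (q : ℕ) (hq : 1 ≤ q) : ∑' x, od q x ≤ 2 * (∑' n, w n) ^ 2 * w q := by
  refine (od_summable q).tsum_le_of_sum_le fun s => ?_
  set Z := ∑' n, w n with hZ
  have hZ0 : 0 ≤ Z := tsum_nonneg w_nn
  obtain ⟨R, hR⟩ : ∃ R, s ⊆ range R ×ˢ range R := by
    refine ⟨(s.sup fun x => max x.1 x.2) + 1, fun x hx => ?_⟩
    have := Finset.le_sup (f := fun x : ℕ × ℕ => max x.1 x.2) hx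
    simp only [mem_product, mem_range] at *
    constructor <;> have := le_max_left x.1 x.2 <;> have := le_max_right x.1 x.2 <;> omega
  refine (sum_le_sum_of_subset_of_nonneg hR fun x _ _ => od_nn q x).trans ?_
  rw [sum_product]
  refine (pairs w w_nn w_anti q R hq).trans ?_
  have h1 : ∑ n ∈ range R, w (n + 1) ≤ Z := by
    refine (w_summable.comp_injective (add_left_injective 1) |>.sum_le_tsum (range R) (fun _ _ => w_nn _)).trans ?_
    exact tsum_comp_le_tsum_of_inj w_summable w_nn (add_left_injective 1)
  have h2 : ∑ j ∈ range R, w (q * (j + 1)) = w q * ∑ n ∈ range R, w (n + 1) := by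
    rw [mul_sum]
    refine sum_congr rfl fun j _ => ?_
    unfold w
    rw [Nat.cast_mul, Real.mul_rpow (by positivity) (by positivity)]
  have h3 : 0 ≤ ∑ n ∈ range R, w (n + 1) := sum_nonneg fun _ _ => w_nn _
  rw [h2]
  have h4 : (∑ n ∈ range R, w (n + 1)) ^ 2 ≤ Z ^ 2 := by gcongr
  nlinarith [w_nn q]

lemma exp_bd {t : ℝ} (ht : 0 < t) : Real.exp (-t) ≤ t ^ (-(1 / 2) : ℝ) := by
  rw [← Real.exp_log (Real.rpow_pos_of_pos ht _), Real.exp_le_exp, Real.log_rpow ht]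
  have := Real.log_le_sub_one_of_pos ht
  linarith

lemma exp_bd2 {t : ℝ} (ht : 0 ≤ t) : 1 - Real.exp (-t) ≤ t ^ (1 / 10 : ℝ) := by
  rcases le_total 1 t with h | h
  · have := Real.one_le_rpow h (by norm_num : (0:ℝ) ≤ 1 / 10)
    have := Real.exp_pos (-t)
    linarith
  · have h1 := Real.add_one_le_exp (-t)
    rcases ht.eq_or_lt with rfl | h0
    · simp
    have h2 := Real.rpow_le_rpow_of_exponent_ge h0 h (by norm_num : (1 / 10 : ℝ) ≤ 1)
    rw [Real.rpow_one] at h2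
    linarith

/-- kernel -/
noncomputable def Fk (q : ℕ) (X : ℝ) (m n : ℕ) : ℝ :=
  if m ≡ n [MOD coprimePart q (m * n)] then
    (Nat.totient (coprimePart q (m * n)) : ℝ) * Real.exp (-((m * n : ℕ) : ℝ) / X) / ((m * n : ℕ) : ℝ) else 0

lemma Fk_nn (q : ℕ) (X : ℝ) (m n : ℕ) : 0 ≤ Fk q X m n := by
  unfold Fk; split_ifs <;> positivity

/-- diagonal term -/
noncomputable def dg (k q : ℕ) (X : ℝ) (m : ℕ) : ℝ :=
  if ¬ q ∣ m then (vonMangoldt ^ k) m ^ 2 * Real.exp (-(((m:ℝ)) ^ 2 / X)) / (m:ℝ) ^ 2 else 0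

lemma core_bd {k : ℕ} {C : ℝ} (hC : 0 < C) (h : ∀ n : ℕ, (vonMangoldt ^ k) n ≤ C * (n:ℝ) ^ (1 / 4 : ℝ)) {X : ℝ} (hX : 0 < X)
    (m n : ℕ) (hm : m ≠ 0) (hn : n ≠ 0) :
    (vonMangoldt ^ k) m * (vonMangoldt ^ k) n * (Real.exp (-((m * n : ℕ) : ℝ) / X) / ((m * n : ℕ) : ℝ)) ≤
      C ^ 2 * X ^ (1 / 2 : ℝ) * (w m * w n) := by
  have hm' : (0:ℝ) < m := by positivity
  have hn' : (0:ℝ) < n := by positivity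
  have h1 := h m
  have h2 := h n
  have h3 : Real.exp (-((m * n : ℕ) : ℝ) / X) ≤ X ^ (1 / 2 : ℝ) * ((m:ℝ) ^ (-(1/2):ℝ) * (n:ℝ) ^ (-(1/2) : ℝ)) := by
    rw [neg_div]
    refine (exp_bd (by positivity)).trans (le_of_eq ?_)
    push_cast
    rw [Real.div_rpow (by positivity) hX.le, Real.mul_rpow hm'.le hn'.le, Real.rpow_neg hX.le (1/2), div_inv_eq_mul, mul_comm]
  have e : ∀ a : ℝ, 0 < a → a ^ (1 / 4 : ℝ) * a ^ (-(1 / 2) : ℝ) / a = a ^ (-(5 / 4) : ℝ) := by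
    intro a ha
    rw [← Real.rpow_add ha]
    nth_rw 2 [← Real.rpow_one a]
    rw [← Real.rpow_sub ha]; norm_num
  calc _ ≤ (C * (m:ℝ) ^ (1 / 4 : ℝ)) * (C * (n:ℝ) ^ (1 / 4 : ℝ)) * (X ^ (1 / 2 : ℝ) * ((m:ℝ) ^ (-(1/2):ℝ) * (n:ℝ) ^ (-(1/2) : ℝ)) / ((m * n : ℕ) : ℝ)) := by
        have := (lam_bd k n).1
        gcongr
    _ = _ := by
        unfold w
        rw [← e m hm', ← e n hn']
        push_cast
        field_simp

lemma main_split {k : ℕ} {C : ℝ} (hC : 0 < C) (h : ∀ n : ℕ, (vonMangoldt ^ k) n ≤ C * (n:ℝ) ^ (1 / 4 : ℝ)) {X : ℝ} (hX : 0 < X)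
    {q : ℕ} (hq : q.Prime) (x : ℕ × ℕ) :
    0 ≤ (vonMangoldt ^ k) x.1 * (vonMangoldt ^ k) x.2 * Fk q X x.1 x.2 - (if x.1 = x.2 then ((q:ℝ) - 1) * dg k q X x.1 else 0) ∧
    (vonMangoldt ^ k) x.1 * (vonMangoldt ^ k) x.2 * Fk q X x.1 x.2 - (if x.1 = x.2 then ((q:ℝ) - 1) * dg k q X x.1 else 0) ≤
      C ^ 2 * X ^ (1 / 2 : ℝ) * (q * od q x + w x.1 * w x.2) := by
  obtain ⟨m, n⟩ := x
  simp only
  have hq0 : (1:ℝ) ≤ q := by exact_mod_cast hq.one_lt.le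
  have hR : 0 ≤ C ^ 2 * X ^ (1 / 2 : ℝ) * (q * od q (m, n) + w m * w n) := by
    have := od_nn q (m, n)
    have := w_nn m
    have := w_nn n
    positivity
  by_cases h0 : m = 0 ∨ n = 0
  · have e1 : (vonMangoldt ^ k) m * (vonMangoldt ^ k) n * Fk q X m n = 0 := by
      rcases h0 with rfl | rfl <;> simp
    have e2 : (if m = n then ((q:ℝ) - 1) * dg k q X m else 0) = 0 := by
      split_ifs with hmn
      · have : m = 0 := by omega
        simp [dg, this]
      · rfl
    rw [e1, e2, sub_zero]
    exact ⟨le_rfl, hR⟩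
  push Not at h0
  obtain ⟨hm, hn⟩ := h0
  have hcore := core_bd hC h hX m n hm hn
  have hcore0 : 0 ≤ (vonMangoldt ^ k) m * (vonMangoldt ^ k) n * (Real.exp (-((m * n : ℕ) : ℝ) / X) / ((m * n : ℕ) : ℝ)) :=
    mul_nonneg (mul_nonneg (lam_bd _ _).1 (lam_bd _ _).1) (by positivity)
  set P := C ^ 2 * X ^ (1 / 2 : ℝ) with hP
  have hP0 : 0 ≤ P := by positivity
  by_cases hd : q ∣ m * n
  · have hF : Fk q X m n = Real.exp (-((m * n : ℕ) : ℝ) / X) / ((m * n : ℕ) : ℝ) := by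
      unfold Fk
      rw [coprimePart_of_dvd hq hd, if_pos (Nat.modEq_one), Nat.totient_one, Nat.cast_one, one_mul]
    have e2 : (if m = n then ((q:ℝ) - 1) * dg k q X m else 0) = 0 := by
      split_ifs with hmn
      · have : q ∣ m := by
          rw [← hmn] at hd
          exact (hq.dvd_mul.1 hd).elim id id
        simp [dg, this]
      · rfl
    rw [hF, e2, sub_zero]
    refine ⟨hcore0, hcore.trans ?_⟩
    have := od_nn q (m, n)
    have : 0 ≤ P * (q * od q (m, n)) := by positivity
    linarith
  · have hqm : ¬ q ∣ m := fun h => hd (h.mul_right n)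
    have htot : ((Nat.totient q : ℕ) : ℝ) = (q:ℝ) - 1 := by
      rw [Nat.totient_prime hq, Nat.cast_sub hq.one_lt.le, Nat.cast_one]
    have hF : Fk q X m n = if m ≡ n [MOD q] then ((q:ℝ) - 1) * (Real.exp (-((m * n : ℕ) : ℝ) / X) / ((m * n : ℕ) : ℝ)) else 0 := by
      unfold Fk
      rw [coprimePart_of_not_dvd hq hd, htot, mul_div_assoc]
    rw [hF]
    by_cases hmn : m = n
    · subst hmn
      rw [if_pos (Nat.ModEq.refl m), if_pos rfl, dg, if_pos hqm]
      have : (vonMangoldt ^ k) m * (vonMangoldt ^ k) m * (((q:ℝ) - 1) * (Real.exp (-((m * m : ℕ) : ℝ) / X) / ((m * m : ℕ) : ℝ))) -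
        ((q:ℝ) - 1) * ((vonMangoldt ^ k) m ^ 2 * Real.exp (-(((m:ℝ)) ^ 2 / X)) / (m:ℝ) ^ 2) = 0 := by
        push_cast
        rw [← sq (m:ℝ), neg_div]
        ring
      rw [this]
      exact ⟨le_rfl, hR⟩
    · rw [if_neg hmn, sub_zero]
      by_cases hc : m ≡ n [MOD q]
      · rw [if_pos hc]
        have e : od q (m, n) = w m * w n := by
          unfold od; rw [if_pos ⟨hc, hmn, hm, hn⟩]
        rw [e]
        have hw := mul_nonneg (w_nn m) (w_nn n)
        have hq1 : 0 ≤ (q:ℝ) - 1 := by linarith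
        set core := (vonMangoldt ^ k) m * (vonMangoldt ^ k) n * (Real.exp (-((m * n : ℕ) : ℝ) / X) / ((m * n : ℕ) : ℝ)) with hcd
        have e3 : (vonMangoldt ^ k) m * (vonMangoldt ^ k) n * (((q:ℝ) - 1) * (Real.exp (-((m * n : ℕ) : ℝ) / X) / ((m * n : ℕ) : ℝ))) =
            ((q:ℝ) - 1) * core := by rw [hcd]; ring
        rw [e3]
        refine ⟨by positivity, (mul_le_mul_of_nonneg_left hcore hq1).trans ?_⟩
        have := mul_nonneg hP0 hw
        nlinarith
      · rw [if_neg hc, mul_zero]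
        exact ⟨le_rfl, hR⟩

end TEC

namespace TEC
open Finset

/-- weight for the diagonal -/
noncomputable def v (n : ℕ) : ℝ := (n:ℝ) ^ (-(13 / 10) : ℝ)

lemma v_nn (n : ℕ) : 0 ≤ v n := by unfold v; positivity

lemma v_summable : Summable v := Real.summable_nat_rpow.2 (by norm_num)

lemma sq_bd {k : ℕ} {C : ℝ} (h : ∀ n : ℕ, (vonMangoldt ^ k) n ≤ C * (n:ℝ) ^ (1 / 4 : ℝ)) (m : ℕ) :
    (vonMangoldt ^ k) m ^ 2 / (m:ℝ) ^ 2 ≤ C ^ 2 * (m:ℝ) ^ (-(3 / 2) : ℝ) := by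
  rcases Nat.eq_zero_or_pos m with rfl | hm
  · simp
  have hm' : (0:ℝ) < m := by exact_mod_cast hm
  have h0 := (lam_bd k m).1
  calc _ ≤ (C * (m:ℝ) ^ (1 / 4 : ℝ)) ^ 2 / (m:ℝ) ^ 2 := by gcongr; exact h m
    _ = C ^ 2 * (((m:ℝ) ^ (1 / 4 : ℝ)) ^ 2 / (m:ℝ) ^ 2) := by ring
    _ = _ := by
      congr 1
      rw [← Real.rpow_natCast, ← Real.rpow_natCast, ← Real.rpow_mul hm'.le, ← Real.rpow_sub hm']
      norm_num

lemma sq_bd_v {k : ℕ} {C : ℝ} (h : ∀ n : ℕ, (vonMangoldt ^ k) n ≤ C * (n:ℝ) ^ (1 / 4 : ℝ)) (m : ℕ) :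
    (vonMangoldt ^ k) m ^ 2 / (m:ℝ) ^ 2 ≤ C ^ 2 * v m := by
  refine (sq_bd h m).trans ?_
  unfold v
  rcases Nat.eq_zero_or_pos m with rfl | hm
  · simp
  have : (1:ℝ) ≤ m := by exact_mod_cast hm
  exact mul_le_mul_of_nonneg_left (Real.rpow_le_rpow_of_exponent_le this (by norm_num)) (sq_nonneg C)

lemma dg_nn (k q : ℕ) (X : ℝ) (m : ℕ) : 0 ≤ dg k q X m := by
  unfold dg; split_ifs <;> positivity

lemma dg_summable {k : ℕ} {C : ℝ} (h : ∀ n : ℕ, (vonMangoldt ^ k) n ≤ C * (n:ℝ) ^ (1 / 4 : ℝ)) {X : ℝ} (hX : 0 < X) (q : ℕ) :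
    Summable (dg k q X) := by
  refine Summable.of_nonneg_of_le (dg_nn k q X) (fun m => ?_) (v_summable.mul_left (C ^ 2))
  refine le_trans ?_ (sq_bd_v h m)
  unfold dg
  split_ifs
  · positivity
  · have : Real.exp (-((m:ℝ) ^ 2 / X)) ≤ 1 := Real.exp_le_one_iff.2 (neg_nonpos.2 (by positivity))
    gcongr
    exact mul_le_of_le_one_right (sq_nonneg _) this

lemma diag_diff {k : ℕ} {C : ℝ} (h : ∀ n : ℕ, (vonMangoldt ^ k) n ≤ C * (n:ℝ) ^ (1 / 4 : ℝ)) {X : ℝ} (hX : 0 < X)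
    {q : ℕ} (hq : 1 ≤ q) (hXq : X ≤ q) :
    |(∑' m, dg k q X m) - ∑' m : ℕ, (if ¬ q ∣ m then (tr (q ^ 4) vonMangoldt ^ k) m ^ 2 / (m:ℝ) ^ 2 else 0)| ≤
      C ^ 2 * (∑' m, v m) * X ^ (-(1 / 10) : ℝ) := by
  have s1 : Summable (fun m : ℕ => (if ¬ q ∣ m then (tr (q ^ 4) vonMangoldt ^ k) m ^ 2 / (m:ℝ) ^ 2 else 0)) := by
    refine Summable.of_nonneg_of_le (fun m => ?_) (fun m => ?_) (v_summable.mul_left (C ^ 2))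
    · split_ifs <;> positivity
    · refine le_trans ?_ (sq_bd_v h m)
      have h1 := tr_pow_bd (q ^ 4) k m
      split_ifs
      · positivity
      · have := h1.1
        gcongr
        exact h1.2
  have hterm : ∀ m : ℕ, ‖dg k q X m - (if ¬ q ∣ m then (tr (q ^ 4) vonMangoldt ^ k) m ^ 2 / (m:ℝ) ^ 2 else 0)‖ ≤
      C ^ 2 * X ^ (-(1 / 10) : ℝ) * v m := by
    intro m
    have hv := v_nn m
    unfold dg
    split_ifs with hd
    · simp; positivity
    rcases Nat.eq_zero_or_pos m with rfl | hm
    · exact absurd (dvd_zero q) hd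
    have hm' : (0:ℝ) < m := by exact_mod_cast hm
    set t := (m:ℝ) ^ 2 / X with ht
    have ht0 : 0 ≤ t := by positivity
    have hsq := sq_bd h m
    have hE := Real.exp_pos (-t)
    have hE1 : Real.exp (-t) ≤ 1 := Real.exp_le_one_iff.2 (neg_nonpos.2 ht0)
    set S := (vonMangoldt ^ k) m ^ 2 / (m:ℝ) ^ 2 with hS
    have hS0 : 0 ≤ S := by positivity
    have key : ‖(vonMangoldt ^ k) m ^ 2 * Real.exp (-t) / (m:ℝ) ^ 2 - (tr (q ^ 4) vonMangoldt ^ k) m ^ 2 / (m:ℝ) ^ 2‖ ≤ S * t ^ (1 / 10 : ℝ) := by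
      have e : (vonMangoldt ^ k) m ^ 2 * Real.exp (-t) / (m:ℝ) ^ 2 = S * Real.exp (-t) := by rw [hS]; ring
      rw [e, Real.norm_eq_abs]
      by_cases hle : m ≤ q ^ 4
      · rw [tr_pow_eq _ _ _ hle, ← hS]
        have := exp_bd2 ht0
        rw [show S * Real.exp (-t) - S = -(S * (1 - Real.exp (-t))) by ring, abs_neg, abs_of_nonneg (mul_nonneg hS0 (by linarith))]
        gcongr
      · have h1 := tr_pow_bd (q ^ 4) k m
        have hb : (tr (q ^ 4) vonMangoldt ^ k) m ^ 2 / (m:ℝ) ^ 2 ≤ S := by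
          have := h1.1
          rw [hS]; gcongr; exact h1.2
        have hb0 : 0 ≤ (tr (q ^ 4) vonMangoldt ^ k) m ^ 2 / (m:ℝ) ^ 2 := by positivity
        have ht1 : 1 ≤ t := by
          rw [ht, le_div_iff₀ hX, one_mul]
          have : q ≤ m ^ 2 := by
            calc q ≤ q ^ 4 := Nat.le_self_pow (by norm_num) q
              _ ≤ m := by omega
              _ ≤ m ^ 2 := Nat.le_self_pow (by norm_num) m
          exact hXq.trans (by exact_mod_cast this)
        have h2 := Real.one_le_rpow ht1 (by norm_num : (0:ℝ) ≤ 1 / 10)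
        have h3 : S ≤ S * t ^ (1 / 10 : ℝ) := le_mul_of_one_le_right hS0 h2
        have h4 : S * Real.exp (-t) ≤ S := mul_le_of_le_one_right hS0 hE1
        have h5 : 0 ≤ S * Real.exp (-t) := by positivity
        rw [abs_le]
        constructor <;> linarith
    refine key.trans ?_
    calc S * t ^ (1 / 10 : ℝ) ≤ (C ^ 2 * (m:ℝ) ^ (-(3 / 2) : ℝ)) * t ^ (1 / 10 : ℝ) := by gcongr
      _ = _ := by
        rw [ht, Real.div_rpow (by positivity) hX.le, ← Real.rpow_natCast (m:ℝ) 2, ← Real.rpow_mul hm'.le, Real.rpow_neg hX.le]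
        have e : (m:ℝ) ^ (-(3 / 2) : ℝ) * (m:ℝ) ^ (((2:ℕ):ℝ) * (1 / 10)) = v m := by
          unfold v
          rw [← Real.rpow_add hm']; norm_num
        rw [← e]; ring
  rw [← (dg_summable h hX q).tsum_sub s1]
  have := tsum_of_norm_bounded (v_summable.mul_left (C ^ 2 * X ^ (-(1 / 10) : ℝ))).hasSum hterm
  rw [Real.norm_eq_abs, tsum_mul_left] at this
  refine this.trans (le_of_eq (by ring))

lemma tuple_side {k : ℕ} {C : ℝ} (hC : 0 < C) (h : ∀ n : ℕ, (vonMangoldt ^ k) n ≤ C * (n:ℝ) ^ (1 / 4 : ℝ)) {X : ℝ} (hX : 0 < X)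
    {q : ℕ} (hq : q.Prime) (hXq : X ≤ q) :
    |(∑' x : ℕ × ℕ, (vonMangoldt ^ k) x.1 * (vonMangoldt ^ k) x.2 * Fk q X x.1 x.2) - ((q:ℝ) - 1) * ∑' m, dg k q X m| ≤
      3 * C ^ 2 * (∑' n, w n) ^ 2 * (q:ℝ) ^ (1 / 2 : ℝ) := by
  have hq0 : (1:ℝ) ≤ q := by exact_mod_cast hq.one_lt.le
  have hq' : (0:ℝ) < q := by linarith
  set dd : ℕ × ℕ → ℝ := fun x => if x.1 = x.2 then ((q:ℝ) - 1) * dg k q X x.1 else 0 with hdd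
  set g : ℕ × ℕ → ℝ := fun x => (vonMangoldt ^ k) x.1 * (vonMangoldt ^ k) x.2 * Fk q X x.1 x.2 with hg
  have hinj : Function.Injective (fun m : ℕ => (m, m)) := fun a b hab => (Prod.mk.inj hab).1
  have hd : HasSum dd (((q:ℝ) - 1) * ∑' m, dg k q X m) := by
    rw [← hinj.hasSum_iff]
    · have := (dg_summable h hX q).hasSum.mul_left ((q:ℝ) - 1)
      have e : dd ∘ (fun m : ℕ => (m, m)) = fun i => ((q:ℝ) - 1) * dg k q X i := by
        funext m; simp [hdd]
      rw [e]; exact this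
    · rintro ⟨a, b⟩ hx
      rw [hdd]
      simp only
      rw [if_neg]
      rintro rfl
      exact hx ⟨a, rfl⟩
  have hsp := main_split hC h hX hq
  have hub : Summable (fun x : ℕ × ℕ => C ^ 2 * X ^ (1 / 2 : ℝ) * (q * od q x + w x.1 * w x.2)) :=
    (((od_summable q).mul_left _).add w_pair_summable).mul_left _
  have hr : Summable (fun x => g x - dd x) :=
    Summable.of_nonneg_of_le (fun x => (hsp x).1) (fun x => (hsp x).2) hub
  have hgs : Summable g := by
    have := hr.add hd.summable
    simpa using this
  rw [← hd.tsum_eq, ← hgs.tsum_sub hd.summable, abs_of_nonneg (tsum_nonneg fun x => (hsp x).1)]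
  refine (hr.tsum_le_tsum (fun x => (hsp x).2) hub).trans ?_
  rw [tsum_mul_left, ((od_summable q).mul_left (q:ℝ)).tsum_add w_pair_summable, tsum_mul_left, w_pair_tsum]
  have ho := od_tsum q hq.one_lt.le
  set Z := ∑' n, w n
  have hw : (q:ℝ) * w q ≤ 1 := by
    unfold w
    nth_rw 1 [← Real.rpow_one (q:ℝ)]
    rw [← Real.rpow_add hq']
    exact Real.rpow_le_one_of_one_le_of_nonpos hq0 (by norm_num)
  have h1 : (q:ℝ) * ∑' x, od q x ≤ 2 * Z ^ 2 := by
    calc _ ≤ (q:ℝ) * (2 * Z ^ 2 * w q) := by gcongr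
      _ = 2 * Z ^ 2 * (q * w q) := by ring
      _ ≤ 2 * Z ^ 2 * 1 := by gcongr
      _ = _ := mul_one _
  calc _ ≤ C ^ 2 * (q:ℝ) ^ (1 / 2 : ℝ) * (2 * Z ^ 2 + Z ^ 2) := by
        have : 0 ≤ ∑' x, od q x := tsum_nonneg (od_nn q)
        gcongr
    _ = _ := by ring

end TEC

theorem two_evaluations_comparison (k : ℕ) (hk : 1 ≤ k) :
    ∃ c : ℝ, 0 < c ∧ ∃ C : ℝ, ∀ q : ℕ, q.Prime → Odd q →
      ∀ X : ℝ, 2 ≤ X → X ≤ (q : ℝ) →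
      |(∑' p : (Fin k → ℕ) × (Fin k → ℕ),
          if (∀ i, 1 ≤ p.1 i) ∧ (∀ i, 1 ≤ p.2 i) ∧
              (∏ i, p.1 i) ≡ (∏ i, p.2 i)
                [MOD coprimePart q ((∏ i, p.1 i) * (∏ i, p.2 i))] then
            (Nat.totient (coprimePart q ((∏ i, p.1 i) * (∏ i, p.2 i))) : ℝ) *
              (∏ i, vonMangoldt (p.1 i) * vonMangoldt (p.2 i)) *
              Real.exp (-((((∏ i, p.1 i) * (∏ i, p.2 i) : ℕ)) : ℝ) / X) /
              (((∏ i, p.1 i) * (∏ i, p.2 i) : ℕ) : ℝ)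
          else 0) -
        charMomentSum q k| ≤
      C * ((q : ℝ) ^ ((3 : ℝ) / 5) * X ^ (-(c / Real.log q)) +
        (q : ℝ) * X ^ (-(1 : ℝ) / 10)) := by
  obtain ⟨C0, hC0, h0⟩ := TEC.lam_rpow k
  obtain ⟨C1, hC1, h1⟩ := TEC.cmp k hk
  obtain ⟨C2, hC2, h2⟩ := TEC.arch k hk
  have hV0 : 0 ≤ ∑' m, TEC.v m := tsum_nonneg TEC.v_nn
  refine ⟨1, one_pos, C1 + C2 + C0 ^ 2 * (∑' m, TEC.v m) + 3 * C0 ^ 2 * (∑' n, TEC.w n) ^ 2, fun q hq _ X hX2 hXq => ?_⟩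
  have : NeZero q := ⟨hq.ne_zero⟩
  have hX : 0 < X := by linarith
  have hq0 : (1:ℝ) ≤ q := by exact_mod_cast hq.one_lt.le
  have hq' : (0:ℝ) < q := by linarith
  have e1 : (∑' p : (Fin k → ℕ) × (Fin k → ℕ),
          if (∀ i, 1 ≤ p.1 i) ∧ (∀ i, 1 ≤ p.2 i) ∧
              (∏ i, p.1 i) ≡ (∏ i, p.2 i)
                [MOD coprimePart q ((∏ i, p.1 i) * (∏ i, p.2 i))] then
            (Nat.totient (coprimePart q ((∏ i, p.1 i) * (∏ i, p.2 i))) : ℝ) *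
              (∏ i, vonMangoldt (p.1 i) * vonMangoldt (p.2 i)) *
              Real.exp (-((((∏ i, p.1 i) * (∏ i, p.2 i) : ℕ)) : ℝ) / X) /
              (((∏ i, p.1 i) * (∏ i, p.2 i) : ℕ) : ℝ)
          else 0) = ∑' x : ℕ × ℕ, (vonMangoldt ^ k) x.1 * (vonMangoldt ^ k) x.2 * TEC.Fk q X x.1 x.2 := by
    rw [← TEC.regroup k (TEC.Fk q X) (TEC.Fk_nn q X)]
    refine tsum_congr fun p => ?_
    obtain ⟨a, b⟩ := p
    simp only
    by_cases ha : ∀ i, 1 ≤ a i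
    swap
    · rw [if_neg (fun h => ha h.1)]
      push Not at ha
      obtain ⟨i, hi⟩ := ha
      have hz : ∏ i, vonMangoldt (a i) = 0 :=
        Finset.prod_eq_zero (Finset.mem_univ i) (by rw [show a i = 0 by omega]; simp)
      rw [hz, zero_mul, zero_mul]
    by_cases hb : ∀ i, 1 ≤ b i
    swap
    · rw [if_neg (fun h => hb h.2.1)]
      push Not at hb
      obtain ⟨i, hi⟩ := hb
      have hz : ∏ i, vonMangoldt (b i) = 0 :=
        Finset.prod_eq_zero (Finset.mem_univ i) (by rw [show b i = 0 by omega]; simp)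
      rw [hz, mul_zero, zero_mul]
    rw [Finset.prod_mul_distrib, TEC.Fk]
    by_cases hc : (∏ i, a i) ≡ (∏ i, b i) [MOD coprimePart q ((∏ i, a i) * (∏ i, b i))]
    · rw [if_pos ⟨ha, hb, hc⟩, if_pos hc]; ring
    · rw [if_neg (fun h => hc h.2.2), if_neg hc, mul_zero]
  have e2 : charMomentSum q k = ∑ χ : DirichletCharacter ℂ q,
      if χ ≠ 1 then ‖logDeriv (DirichletCharacter.LFunction χ) 1‖ ^ (2 * k) else 0 := by
    rw [charMomentSum, dif_pos hq.two_le]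
  rw [e1, e2]
  have a1 := h1 q hq
  have a2 := h2 q hq
  have a3 := TEC.diag_diff h0 hX hq.one_lt.le hXq
  have a4 := TEC.tuple_side hC0 h0 hX hq hXq
  generalize (∑' x : ℕ × ℕ, (vonMangoldt ^ k) x.1 * (vonMangoldt ^ k) x.2 * TEC.Fk q X x.1 x.2) = T at *
  generalize (∑ χ : DirichletCharacter ℂ q,
      if χ ≠ 1 then ‖logDeriv (DirichletCharacter.LFunction χ) 1‖ ^ (2 * k) else 0) = M at *
  generalize (∑ χ : DirichletCharacter ℂ q,
      if χ ≠ 1 then ‖TEC.Dl χ (TEC.tr (q ^ 4) vonMangoldt)‖ ^ (2 * k) else 0) = A at *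
  generalize (∑' m, TEC.dg k q X m) = D at *
  generalize (∑' m : ℕ, (if ¬ q ∣ m then (TEC.tr (q ^ 4) vonMangoldt ^ k) m ^ 2 / (m:ℝ) ^ 2 else 0)) = E at *
  generalize (∑' m, TEC.v m) = V at *
  generalize (∑' n, TEC.w n) = Z at *
  set Y := (q:ℝ) * X ^ (-(1:ℝ) / 10) with hY
  have hXe : X ^ (-(1 / 10) : ℝ) = X ^ (-(1:ℝ) / 10) := by norm_num
  have hXp : 0 < X ^ (-(1:ℝ) / 10) := Real.rpow_pos_of_pos hX _
  have b1 : (q:ℝ) ^ (9 / 10 : ℝ) ≤ Y := by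
    have e : (q:ℝ) ^ (9 / 10 : ℝ) = q * (q:ℝ) ^ (-(1:ℝ) / 10) := by
      nth_rw 2 [← Real.rpow_one (q:ℝ)]
      rw [← Real.rpow_add hq']; norm_num
    rw [e, hY]
    refine mul_le_mul_of_nonneg_left ?_ hq'.le
    exact Real.rpow_le_rpow_of_nonpos hX hXq (by norm_num)
  have b2 : (q:ℝ) ^ (1 / 2 : ℝ) ≤ Y :=
    (Real.rpow_le_rpow_of_exponent_le hq0 (by norm_num)).trans b1
  have b3 : |((q:ℝ) - 1) * (D - E)| ≤ C0 ^ 2 * V * Y := by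
    rw [abs_mul, abs_of_nonneg (by linarith)]
    calc _ ≤ (q:ℝ) * (C0 ^ 2 * V * X ^ (-(1 / 10) : ℝ)) :=
          mul_le_mul (by linarith) a3 (abs_nonneg _) hq'.le
      _ = _ := by rw [hXe, hY]; ring
  have b4 : C1 * (q:ℝ) ^ (9 / 10 : ℝ) ≤ C1 * Y := by gcongr
  have b5 : C2 * (q:ℝ) ^ (9 / 10 : ℝ) ≤ C2 * Y := by gcongr
  have b6 : 3 * C0 ^ 2 * Z ^ 2 * (q:ℝ) ^ (1 / 2 : ℝ) ≤ 3 * C0 ^ 2 * Z ^ 2 * Y := by gcongr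
  have b7 : |T - M| ≤ (C1 + C2 + C0 ^ 2 * V + 3 * C0 ^ 2 * Z ^ 2) * Y := by
    have e : T - M = (T - ((q:ℝ) - 1) * D) + ((q:ℝ) - 1) * (D - E) - (A - ((q:ℝ) - 1) * E) - (M - A) := by ring
    rw [e]
    rw [abs_le] at *
    constructor <;> linarith [a1.1, a1.2, a2.1, a2.2, a4.1, a4.2, b3.1, b3.2]
  refine b7.trans ?_
  have hn : 0 ≤ (q:ℝ) ^ ((3:ℝ) / 5) * X ^ (-(1 / Real.log q)) := by positivity
  have hCn : 0 ≤ C1 + C2 + C0 ^ 2 * V + 3 * C0 ^ 2 * Z ^ 2 := by positivity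
  exact mul_le_mul_of_nonneg_left (by linarith) hCn
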